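/- arXiv:1812.10588 — 8 statements merged into one kernel-verified Lean document; each statement's English description precedes it below -/
import Mathlib

section
/- Let δ be a positive odd integer and let u : ℝ^n → ℝ be continuously differentiable and satisfy: (i) −∇u(x)·f(x,d) − δ·q(x)·(1 − u(x)) ≥ 0 for all x ∈ B̄ ∖ X∞ and all d ∈ D; (ii) u(x) + (1 − h_j(x))^δ − 1 ≥ 0 for all j = 1,…,n_X and all x ∈ closure(X) ∖ X∞; (iii) u(x) − 1 ≥ 0 for all x ∈ B̄ ∖ X. Then Ω := {x ∈ B̄ : u(x) < 1} is a robust domain of attraction, i.e. Ω ⊆ R: for every x₀ ∈ Ω and every admissible input d there exists a trajectory of f from x₀ under d on [0,∞), and every such trajectory remains in X for all t ≥ 0 and converges to 0 as t → ∞. -/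
open MeasureTheory Metric Set Filter Topology

open scoped ENNReal NNReal

attribute [local instance] Classical.propDecidable

noncomputable section

/-- Euclidean state space ℝ^n. -/
abbrev Eu (n : ℕ) : Type := EuclideanSpace ℝ (Fin n)

/-- An admissible perturbation input: a measurable function taking values in D. -/
def IsAdmissible {m : ℕ} (D : Set (Eu m)) (d : ℝ → Eu m) : Prop :=
  Measurable d ∧ ∀ t : ℝ, d t ∈ D

/-- ψ is a trajectory of ẋ = f(x, d(t)) from x₀ on the time set I (0 ∈ I). -/
def IsTrajOn {n m : ℕ} (f : Eu n → Eu m → Eu n) (x₀ : Eu n) (d : ℝ → Eu m)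
    (I : Set ℝ) (ψ : ℝ → Eu n) : Prop :=
  ContinuousOn ψ I ∧ ∀ t ∈ I, ψ t = x₀ + ∫ s in (0:ℝ)..t, f (ψ s) (d s)

/-- f : ℝ^n × ℝ^m → ℝ^n is a polynomial map. -/
def IsPolyMap {n m : ℕ} (f : Eu n → Eu m → Eu n) : Prop :=
  ∃ p : Fin n → MvPolynomial (Fin n ⊕ Fin m) ℝ,
    ∀ x d i, f x d i = MvPolynomial.eval (Sum.elim (fun j => x j) (fun j => d j)) (p i)

/-- q : ℝ^n → ℝ is a polynomial function. -/
def IsPolyFun {n : ℕ} (q : Eu n → ℝ) : Prop :=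
  ∃ p : MvPolynomial (Fin n) ℝ, ∀ x, q x = MvPolynomial.eval (fun j => x j) p

theorem IsPolyFun.continuous {n : ℕ} {q : Eu n → ℝ} (hq : IsPolyFun q) : Continuous q := by
  obtain ⟨p, hp⟩ := hq
  rw [funext hp]
  exact (MvPolynomial.continuous_eval p).comp (by fun_prop)

theorem IsPolyMap.contDiff {n m : ℕ} {f : Eu n → Eu m → Eu n} (hf : IsPolyMap f) :
    ContDiff ℝ 1 (Function.uncurry f) := by
  obtain ⟨p, hp⟩ := hf
  rw [contDiff_euclidean]
  intro i
  have heq : (fun z : Eu n × Eu m => Function.uncurry f z i) = fun z =>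
      MvPolynomial.eval (Sum.elim (fun j => z.1 j) (fun j => z.2 j)) (p i) :=
    funext fun z => hp z.1 z.2 i
  rw [heq]
  induction p i using MvPolynomial.induction_on with
  | C a => simpa using contDiff_const
  | add p q hp hq => simpa using hp.add hq
  | mul_X p k hp =>
    simp only [map_mul, MvPolynomial.eval_X]
    refine hp.mul ?_
    rcases k with j | j
    · exact (contDiff_euclidean.1 contDiff_fst j)
    · exact (contDiff_euclidean.1 contDiff_snd j)

/-- A jointly `C¹` vector field agrees, on a bounded set of states and inputs, with one that is
globally Lipschitz. -/
theorem exists_lipschitzWith_eqOn {n m : ℕ} {f : Eu n → Eu m → Eu n}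
    (hf : ContDiff ℝ 1 (Function.uncurry f)) {B : Set (Eu n)} {D : Set (Eu m)}
    (hB : Bornology.IsBounded B) (hD : Bornology.IsBounded D) :
    ∃ F : Eu n → Eu m → Eu n, (∃ K : ℝ≥0, LipschitzWith K (Function.uncurry F)) ∧
      ∀ x ∈ B, ∀ d ∈ D, F x d = f x d := by
  obtain ⟨r, hr0, hr⟩ := (hB.prod hD).subset_closedBall_lt 0 (0 : Eu n × Eu m)
  let b : ContDiffBump (0 : Eu n × Eu m) := ⟨r, r + 1, hr0, by linarith⟩
  refine ⟨fun x d => b (x, d) • f x d, ?_, fun x hx d hd => ?_⟩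
  · exact ContDiff.lipschitzWith_of_hasCompactSupport (f := fun z => b z • Function.uncurry f z)
      b.hasCompactSupport.smul_right (b.contDiff.smul hf) (by simp)
  · simp [b.one_of_mem_closedBall (hr (Set.mk_mem_prod hx hd))]

theorem intervalIntegrable_of_continuousOn {n m : ℕ} {F : Eu n → Eu m → Eu n}
    (hF : Continuous (Function.uncurry F)) {D : Set (Eu m)} (hD : IsCompact D) {d : ℝ → Eu m}
    (hd : IsAdmissible D d) {ψ : ℝ → Eu n} {a b : ℝ} (hψ : ContinuousOn ψ (uIcc a b)) :
    IntervalIntegrable (fun s => F (ψ s) (d s)) volume a b := by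
  obtain ⟨C, hC⟩ := ((isCompact_uIcc.image_of_continuousOn hψ).prod hD).exists_bound_of_continuousOn
    hF.continuousOn
  rw [intervalIntegrable_iff]
  have hm : AEStronglyMeasurable (fun s => F (ψ s) (d s)) (volume.restrict (uIoc a b)) := by
    have h1 : AEStronglyMeasurable ψ (volume.restrict (uIoc a b)) :=
      (hψ.mono uIoc_subset_uIcc).aestronglyMeasurable measurableSet_uIoc
    exact hF.comp_aestronglyMeasurable (h1.prodMk hd.1.aestronglyMeasurable)
  refine IntegrableOn.of_bound (by simp [uIoc]) hm C ?_
  filter_upwards [ae_restrict_mem measurableSet_uIoc] with s hs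
  exact hC (ψ s, d s) ⟨mem_image_of_mem _ (uIoc_subset_uIcc hs), hd.2 s⟩

theorem IsAdmissible.shift {m : ℕ} {D : Set (Eu m)} {d : ℝ → Eu m} (hd : IsAdmissible D d)
    (τ : ℝ) : IsAdmissible D fun t => d (t + τ) :=
  ⟨hd.1.comp (measurable_id.add_const τ), fun t => hd.2 (t + τ)⟩

theorem isTrajOn_Ici_iff {n m : ℕ} {f : Eu n → Eu m → Eu n} {x₀ : Eu n} {d : ℝ → Eu m}
    {ψ : ℝ → Eu n} :
    IsTrajOn f x₀ d (Ici 0) ψ ↔ ∀ b, 0 ≤ b → IsTrajOn f x₀ d (Icc 0 b) ψ := by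
  refine ⟨fun h b _ => ⟨h.1.mono Icc_subset_Ici_self, fun t ht => h.2 t ht.1⟩, fun h => ⟨?_, ?_⟩⟩
  · intro t ht
    have h0 : (0 : ℝ) ≤ t := ht
    refine ((h (t + 1) (by linarith)).1 t ⟨h0, by linarith⟩).mono_of_mem_nhdsWithin ?_
    rw [← Ici_inter_Iic]
    exact inter_mem self_mem_nhdsWithin (mem_nhdsWithin_of_mem_nhds (Iic_mem_nhds (by linarith)))
  · exact fun t ht => (h t ht).2 t ⟨ht, le_rfl⟩

theorem IsTrajOn.sub_eq_integral {n m : ℕ} {F : Eu n → Eu m → Eu n}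
    (hF : Continuous (Function.uncurry F)) {D : Set (Eu m)} (hD : IsCompact D) {d : ℝ → Eu m}
    (hd : IsAdmissible D d) {x₀ : Eu n} {ψ : ℝ → Eu n} {b : ℝ}
    (hψ : IsTrajOn F x₀ d (Icc 0 b) ψ) {s t : ℝ} (hs : s ∈ Icc 0 b) (ht : t ∈ Icc 0 b) :
    ψ t - ψ s = ∫ r in s..t, F (ψ r) (d r) := by
  have h0 : (0 : ℝ) ∈ Icc 0 b := ⟨le_rfl, hs.1.trans hs.2⟩
  rw [hψ.2 t ht, hψ.2 s hs, add_sub_add_left_eq_sub, intervalIntegral.integral_interval_sub_left]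
  · exact intervalIntegrable_of_continuousOn hF hD hd (hψ.1.mono (uIcc_subset_Icc h0 ht))
  · exact intervalIntegrable_of_continuousOn hF hD hd (hψ.1.mono (uIcc_subset_Icc h0 hs))

theorem IsTrajOn.shift {n m : ℕ} {F : Eu n → Eu m → Eu n}
    (hF : Continuous (Function.uncurry F)) {D : Set (Eu m)} (hD : IsCompact D) {d : ℝ → Eu m}
    (hd : IsAdmissible D d) {x₀ : Eu n} {ψ : ℝ → Eu n}
    (hψ : IsTrajOn F x₀ d (Ici 0) ψ) {τ : ℝ} (hτ : 0 ≤ τ) :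
    IsTrajOn F (ψ τ) (fun t => d (t + τ)) (Ici 0) fun t => ψ (t + τ) := by
  refine ⟨hψ.1.comp (by fun_prop) fun t ht => add_nonneg ht hτ, fun t ht => ?_⟩
  have ht : 0 ≤ t := ht
  have := (isTrajOn_Ici_iff.1 hψ (t + τ) (by positivity)).sub_eq_integral hF hD hd
    (s := τ) (t := t + τ) ⟨hτ, by linarith⟩ ⟨by positivity, le_rfl⟩
  rw [intervalIntegral.integral_comp_add_right (fun r => F (ψ r) (d r)), zero_add, ← this]
  abel

/-- Concatenation of two trajectories. -/
theorem IsTrajOn.concat {n m : ℕ} {F : Eu n → Eu m → Eu n}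
    (hF : Continuous (Function.uncurry F)) {D : Set (Eu m)} (hD : IsCompact D) {d : ℝ → Eu m}
    (hd : IsAdmissible D d) {x₀ : Eu n} {ψ φ : ℝ → Eu n} {τ b : ℝ} (hτ : 0 ≤ τ) (hb : 0 ≤ b)
    (hψ : IsTrajOn F x₀ d (Icc 0 τ) ψ)
    (hφ : IsTrajOn F (ψ τ) (fun t => d (t + τ)) (Icc 0 b) φ) :
    IsTrajOn F x₀ d (Icc 0 (τ + b)) fun t => if t ≤ τ then ψ t else φ (t - τ) := by
  set χ : ℝ → Eu n := fun t => if t ≤ τ then ψ t else φ (t - τ) with hχ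
  have hφ0 : φ 0 = ψ τ := by simpa using hφ.2 0 ⟨le_rfl, hb⟩
  have hχ1 : EqOn χ ψ (Icc 0 τ) := fun t ht => if_pos ht.2
  have hχ2 : EqOn χ (fun t => φ (t - τ)) (Icc τ (τ + b)) := by
    intro t ht
    rcases ht.1.eq_or_lt with rfl | h
    · simp [hχ, hφ0]
    · simp [hχ, not_le.2 h]
  have hc : ContinuousOn χ (Icc 0 (τ + b)) := by
    rw [← Icc_union_Icc_eq_Icc hτ (by linarith : τ ≤ τ + b)]
    refine ContinuousOn.union_of_isClosed (hψ.1.congr hχ1) (ContinuousOn.congr ?_ hχ2)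
      isClosed_Icc isClosed_Icc
    exact hφ.1.comp (by fun_prop) fun t ht => ⟨by linarith [ht.1], by linarith [ht.2]⟩
  have hint : ∀ t ∈ Icc 0 τ, χ t = x₀ + ∫ r in (0 : ℝ)..t, F (χ r) (d r) := by
    intro t ht
    rw [hχ1 ht, hψ.2 t ht]
    congr 1
    refine intervalIntegral.integral_congr fun r hr => ?_
    rw [uIcc_of_le ht.1] at hr
    simp only [hχ1 ⟨hr.1, hr.2.trans ht.2⟩]
  refine ⟨hc, fun t ht => ?_⟩
  rcases le_total t τ with h | h
  · exact hint t ⟨ht.1, h⟩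
  have hi : ∀ s ∈ Icc 0 (τ + b), ∀ t ∈ Icc 0 (τ + b),
      IntervalIntegrable (fun r => F (χ r) (d r)) volume s t := fun s hs t ht =>
    intervalIntegrable_of_continuousOn hF hD hd (hc.mono (uIcc_subset_Icc hs ht))
  have hτ' : τ ∈ Icc 0 (τ + b) := ⟨hτ, by linarith⟩
  rw [← intervalIntegral.integral_add_adjacent_intervals
    (hi 0 ⟨le_rfl, by positivity⟩ τ hτ') (hi τ hτ' t ht), ← add_assoc,
    ← hint τ ⟨hτ, le_rfl⟩, hχ2 ⟨h, ht.2⟩, hχ1 ⟨hτ, le_rfl⟩]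
  simp only
  rw [hφ.2 (t - τ) ⟨by linarith, by linarith [ht.2]⟩]
  congr 1
  have hsub := intervalIntegral.integral_comp_add_right (a := 0) (b := t - τ)
    (fun r => F (φ (r - τ)) (d r)) τ
  simp only [add_sub_cancel_right, zero_add, sub_add_cancel] at hsub
  rw [hsub]
  refine intervalIntegral.integral_congr fun r hr => ?_
  rw [uIcc_of_le h] at hr
  simp only [hχ2 ⟨hr.1, hr.2.trans ht.2⟩]

/-- Local existence for a globally Lipschitz field, with a step uniform in the initial state and
the input. -/
theorem exists_isTrajOn_Icc_of_mul_le {n m : ℕ} {F : Eu n → Eu m → Eu n} {K : ℝ≥0}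
    (hF : LipschitzWith K (Function.uncurry F)) {D : Set (Eu m)} (hD : IsCompact D) {ε : ℝ}
    (hε : 0 ≤ ε) (hKε : K * ε ≤ 1 / 2) (x₀ : Eu n) {d : ℝ → Eu m} (hd : IsAdmissible D d) :
    ∃ ψ, IsTrajOn F x₀ d (Icc 0 ε) ψ := by
  have hint : ∀ ψ : C(Icc (0 : ℝ) ε, Eu n), ∀ a b,
      IntervalIntegrable (fun r => F (IccExtend hε ψ r) (d r)) volume a b := fun ψ a b =>
    intervalIntegrable_of_continuousOn hF.continuous hD hd ψ.continuous.Icc_extend'.continuousOn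
  let Φ : C(Icc (0 : ℝ) ε, Eu n) → C(Icc (0 : ℝ) ε, Eu n) := fun ψ =>
    ⟨fun t => x₀ + ∫ r in (0 : ℝ)..t, F (IccExtend hε ψ r) (d r),
      continuous_const.add ((intervalIntegral.continuous_primitive (hint ψ) 0).comp
        continuous_subtype_val)⟩
  have hΦ : ContractingWith (1 / 2) Φ := by
    refine ⟨by norm_num, LipschitzWith.of_dist_le_mul fun ψ φ => ?_⟩
    rw [ContinuousMap.dist_le (by positivity)]
    intro t
    simp only [Φ, ContinuousMap.coe_mk, dist_add_left]
    rw [dist_eq_norm, ← intervalIntegral.integral_sub (hint ψ 0 t) (hint φ 0 t)]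
    have hle : ∀ r ∈ uIoc (0 : ℝ) t,
        ‖F (IccExtend hε ψ r) (d r) - F (IccExtend hε φ r) (d r)‖ ≤ K * dist ψ φ := by
      intro r _
      rw [← dist_eq_norm]
      refine (hF.dist_le_mul (IccExtend hε ψ r, d r) (IccExtend hε φ r, d r)).trans ?_
      gcongr
      rw [dist_prod_same_right]
      exact ContinuousMap.dist_apply_le_dist (projIcc 0 ε hε r)
    refine (intervalIntegral.norm_integral_le_of_norm_le_const hle).trans ?_
    rw [sub_zero, abs_of_nonneg t.2.1]
    have h1 : K * dist ψ φ * t ≤ K * dist ψ φ * ε := by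
      have := t.2.2
      gcongr
    have h2 : K * ε * dist ψ φ ≤ 1 / 2 * dist ψ φ := by gcongr
    push_cast
    linarith
  obtain ⟨ψ, hψ⟩ : ∃ ψ, Φ ψ = ψ := ⟨_, hΦ.fixedPoint_isFixedPt⟩
  refine ⟨IccExtend hε ψ, ψ.continuous.Icc_extend'.continuousOn, fun t ht => ?_⟩
  rw [IccExtend_of_mem hε _ ht]
  exact (DFunLike.congr_fun hψ ⟨t, ht⟩).symm

theorem exists_isTrajOn_Icc {n m : ℕ} {F : Eu n → Eu m → Eu n} {K : ℝ≥0}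
    (hF : LipschitzWith K (Function.uncurry F)) {D : Set (Eu m)} (hD : IsCompact D)
    (T : ℝ) (x₀ : Eu n) {d : ℝ → Eu m} (hd : IsAdmissible D d) :
    ∃ ψ, IsTrajOn F x₀ d (Icc 0 T) ψ := by
  obtain ⟨ε, hε, hKε⟩ : ∃ ε : ℝ, 0 < ε ∧ K * ε ≤ 1 / 2 := by
    refine ⟨1 / (2 * (K + 1)), by positivity, ?_⟩
    rw [mul_one_div, div_le_div_iff₀ (by positivity) (by norm_num)]
    linarith
  have hk : ∀ k : ℕ, ∃ ψ, IsTrajOn F x₀ d (Icc 0 (k * ε)) ψ := by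
    intro k
    induction k with
    | zero =>
      refine ⟨fun _ => x₀, continuousOn_const, fun t ht => ?_⟩
      have : t = 0 := le_antisymm (by simpa using ht.2) ht.1
      simp [this]
    | succ k ih =>
      obtain ⟨ψ, hψ⟩ := ih
      obtain ⟨φ, hφ⟩ := exists_isTrajOn_Icc_of_mul_le hF hD hε.le hKε (ψ (k * ε))
        (hd.shift (k * ε))
      rw [Nat.cast_succ, add_mul, one_mul]
      exact ⟨_, hψ.concat hF.continuous hD hd (by positivity) hε.le hφ⟩
  obtain ⟨k, hk'⟩ := exists_nat_ge (T / ε)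
  obtain ⟨ψ, hψ⟩ := hk k
  have hT : Icc 0 T ⊆ Icc 0 (k * ε) := Icc_subset_Icc_right ((div_le_iff₀ hε).1 hk')
  exact ⟨ψ, hψ.1.mono hT, fun t ht => hψ.2 t (hT ht)⟩

/-- The upper right Dini derivative of a `C¹` function along a trajectory is bounded by the
largest directional derivative over the admissible inputs. -/
theorem IsTrajOn.eventually_slope_lt {n m : ℕ} {F : Eu n → Eu m → Eu n}
    (hF : Continuous (Function.uncurry F)) {D : Set (Eu m)} (hD : IsCompact D) {d : ℝ → Eu m}
    (hd : IsAdmissible D d) {x₀ : Eu n} {ψ : ℝ → Eu n} {b : ℝ}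
    (hψ : IsTrajOn F x₀ d (Icc 0 b) ψ) {u : Eu n → ℝ} {t : ℝ} (ht : t ∈ Ico 0 b)
    (hu : DifferentiableAt ℝ u (ψ t)) {c r : ℝ}
    (hc : ∀ e ∈ D, fderiv ℝ u (ψ t) (F (ψ t) e) ≤ c) (hcr : c < r) :
    ∀ᶠ z in 𝓝[>] t, (z - t)⁻¹ * (u (ψ z) - u (ψ t)) < r := by
  set L := fderiv ℝ u (ψ t) with hL
  obtain ⟨C, hC⟩ := hD.exists_bound_of_continuousOn (f := fun e => F (ψ t) e)
    (by fun_prop : Continuous fun e => F (ψ t) e).continuousOn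
  set M := |C| + 1 with hM
  have hMpos : 0 < M := by positivity
  set η := (r - c) / 3 with hη
  have hηpos : 0 < η := by linarith
  have hnear : ∀ᶠ y in 𝓝 (ψ t), ∀ e ∈ D, L (F y e) < c + η ∧ ‖F y e‖ < M := by
    refine hD.eventually_forall_of_forall_eventually fun e he => ?_
    have h1 : Continuous fun z : Eu n × Eu m => L (F z.1 z.2) := L.continuous.comp hF
    have h2 : Continuous fun z : Eu n × Eu m => ‖F z.1 z.2‖ := hF.norm
    refine (h1.continuousAt.eventually_lt_const ?_).and (h2.continuousAt.eventually_lt_const ?_)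
    · exact (hc e he).trans_lt (by linarith)
    · exact (hC e he).trans_lt (by linarith [le_abs_self C])
  have hlin : ∀ᶠ y in 𝓝 (ψ t), ‖u y - u (ψ t) - L (y - ψ t)‖ ≤ η / M * ‖y - ψ t‖ :=
    hu.hasFDerivAt.isLittleO.def (by positivity)
  have hcont : Tendsto ψ (𝓝[≥] t) (𝓝 (ψ t)) := by
    refine (hψ.1 t ⟨ht.1, ht.2.le⟩).mono_left (nhdsWithin_le_of_mem ?_)
    exact mem_of_superset (Ico_mem_nhdsGE ht.2) fun z hz => ⟨ht.1.trans hz.1, hz.2.le⟩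
  obtain ⟨w, hw, hsub⟩ := mem_nhdsGE_iff_exists_Ico_subset.1
    (inter_mem (hcont (hnear.and hlin)) (Ico_mem_nhdsGE ht.2))
  have hw : t < w := hw
  filter_upwards [Ioo_mem_nhdsGT hw] with z hz
  have hz0 : 0 < z - t := sub_pos.2 hz.1
  have hzb : z < b := (hsub ⟨hz.1.le, hz.2⟩).2.2
  have hmem : ∀ s ∈ Icc t z, ∀ e ∈ D, L (F (ψ s) e) < c + η ∧ ‖F (ψ s) e‖ < M := fun s hs =>
    (hsub ⟨hs.1, hs.2.trans_lt hz.2⟩).1.1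
  have hdiff := hψ.sub_eq_integral hF hD hd (s := t) (t := z) ⟨ht.1, ht.2.le⟩
    ⟨ht.1.trans hz.1.le, hzb.le⟩
  have hi : IntervalIntegrable (fun s => F (ψ s) (d s)) volume t z :=
    intervalIntegrable_of_continuousOn hF hD hd (hψ.1.mono (uIcc_subset_Icc
      ⟨ht.1, ht.2.le⟩ ⟨ht.1.trans hz.1.le, hzb.le⟩))
  have hLle : L (ψ z - ψ t) ≤ (c + η) * (z - t) := by
    rw [hdiff, ← L.intervalIntegral_comp_comm hi]
    calc ∫ s in t..z, L (F (ψ s) (d s)) ≤ ∫ _ in t..z, (c + η) := by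
          refine intervalIntegral.integral_mono_on hz.1.le ?_ (by simp) fun s hs =>
            (hmem s hs (d s) (hd.2 s)).1.le
          exact ⟨L.integrable_comp hi.1, L.integrable_comp hi.2⟩
      _ = (c + η) * (z - t) := by simp; ring
  have hnorm : ‖ψ z - ψ t‖ ≤ M * (z - t) := by
    rw [hdiff]
    refine (intervalIntegral.norm_integral_le_of_norm_le_const (C := M) fun s hs => ?_).trans ?_
    · rw [uIoc_of_le hz.1.le] at hs
      exact (hmem s ⟨hs.1.le, hs.2⟩ (d s) (hd.2 s)).2.le
    · rw [abs_of_pos hz0]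
  have happ : ‖u (ψ z) - u (ψ t) - L (ψ z - ψ t)‖ ≤ η / M * ‖ψ z - ψ t‖ :=
    (hsub ⟨hz.1.le, hz.2⟩).1.2
  have hfin : u (ψ z) - u (ψ t) ≤ (c + 2 * η) * (z - t) := by
    have h1 := (le_abs_self _).trans happ
    have h2 : η / M * ‖ψ z - ψ t‖ ≤ η / M * (M * (z - t)) := by gcongr
    rw [← mul_assoc, div_mul_cancel₀ _ hMpos.ne'] at h2
    linarith
  rw [inv_mul_lt_iff₀ hz0]
  refine hfin.trans_lt ?_
  rw [mul_comm]
  gcongr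
  linarith

/-- Exponential decay of `u - 1` along a trajectory that stays in `u < 1`, outside `Xinf`. -/
theorem IsTrajOn.sub_one_le_mul_exp {n m : ℕ} {F : Eu n → Eu m → Eu n}
    (hF : Continuous (Function.uncurry F)) {D : Set (Eu m)} (hD : IsCompact D) {d : ℝ → Eu m}
    (hd : IsAdmissible D d) {x₀ : Eu n} {ψ : ℝ → Eu n} {b : ℝ}
    (hψ : IsTrajOn F x₀ d (Icc 0 b) ψ) {u : Eu n → ℝ} (hu : ContDiff ℝ 1 u) {q : Eu n → ℝ}
    {k α : ℝ} (hk : 0 ≤ k)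
    (hdecr : ∀ t ∈ Ico 0 b, ∀ e ∈ D,
      0 ≤ -(fderiv ℝ u (ψ t) (F (ψ t) e)) - k * q (ψ t) * (1 - u (ψ t)))
    (hq : ∀ t ∈ Ico 0 b, α ≤ q (ψ t)) (hu1 : ∀ t ∈ Ico 0 b, u (ψ t) < 1) :
    ∀ t ∈ Icc 0 b, u (ψ t) - 1 ≤ (u (ψ 0) - 1) * Real.exp (k * α * t) := by
  have := le_gronwallBound_of_liminf_deriv_right_le (f := fun t => u (ψ t) - 1)
    (f' := fun t => -(k * q (ψ t) * (1 - u (ψ t)))) (δ := u (ψ 0) - 1) (K := k * α) (ε := 0)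
    (a := 0) (b := b) ((hu.continuous.comp_continuousOn hψ.1).sub continuousOn_const) ?_ le_rfl ?_
  · simpa [gronwallBound_ε0] using this
  · intro t ht r hr
    simp only [sub_sub_sub_cancel_right]
    exact (hψ.eventually_slope_lt hF hD hd ht (hu.differentiable one_ne_zero _)
      (fun e he => by linarith [hdecr t ht e he]) hr).frequently
  · intro t ht
    have h1 : k * α * (1 - u (ψ t)) ≤ k * q (ψ t) * (1 - u (ψ t)) := by
      have := hq t ht
      have : 0 ≤ 1 - u (ψ t) := by linarith [hu1 t ht]
      gcongr
    linarith

/-- A continuous curve starting in an open set stays there if it cannot be outside the set at a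
time before which it was always inside. -/
theorem mapsTo_Icc_of_first_exit {E : Type*} [TopologicalSpace E] {ψ : ℝ → E} {b : ℝ}
    (hψ : ContinuousOn ψ (Icc 0 b)) {U : Set E} (hU : IsOpen U)
    (hstep : ∀ t ∈ Icc 0 b, (∀ s ∈ Ico 0 t, ψ s ∈ U) → ψ t ∈ U) :
    ∀ t ∈ Icc 0 b, ψ t ∈ U := by
  by_contra! hne
  set S : Set ℝ := Icc 0 b ∩ ψ ⁻¹' Uᶜ with hS
  have hSc : IsCompact S := (isCompact_Icc).of_isClosed_subset
    (hψ.preimage_isClosed_of_isClosed isClosed_Icc hU.isClosed_compl) inter_subset_left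
  obtain ⟨t, ht, htS⟩ := hne
  obtain ⟨τ, hτ, hmin⟩ := hSc.exists_isLeast ⟨t, ht, htS⟩
  refine hτ.2 (hstep τ hτ.1 fun s hs => ?_)
  by_contra hsU
  exact absurd (hmin ⟨⟨hs.1, hs.2.le.trans hτ.1.2⟩, hsU⟩) (not_le.2 hs.2)

/-- Along any trajectory from a point of `B` where `u < 1`, the set `Xinf` is hit before a time
depending only on the starting point, and the trajectory stays in `X` until then. -/
theorem exists_time_forall_hits {n m : ℕ} {f : Eu n → Eu m → Eu n} {D : Set (Eu m)}
    (hD : IsCompact D) {X Xinf B : Set (Eu n)} (hX : IsOpen X)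
    (hXB : closure X ⊆ B) {u : Eu n → ℝ} (hu : ContDiff ℝ 1 u) {q : Eu n → ℝ} {k α : ℝ}
    (hk : 0 < k) (hα : 0 < α)
    (hdecr : ∀ x ∈ B \ Xinf, ∀ e ∈ D, 0 ≤ -(fderiv ℝ u x (f x e)) - k * q x * (1 - u x))
    (hq : ∀ x, x ∉ Xinf → α ≤ q x) (hu0 : ∀ x ∈ X \ Xinf, 0 ≤ u x)
    (hu1 : ∀ x ∈ B \ X, 1 ≤ u x) {x₀ : Eu n} (hx₀ : x₀ ∈ B) (hux₀ : u x₀ < 1) :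
    ∃ T : ℝ, ∀ F : Eu n → Eu m → Eu n, Continuous (Function.uncurry F) →
      (∀ x ∈ B, ∀ e ∈ D, F x e = f x e) → ∀ d, IsAdmissible D d →
      ∀ ψ, IsTrajOn F x₀ d (Icc 0 T) ψ →
        ∃ τ ∈ Icc 0 T, ψ τ ∈ Xinf ∧ ∀ t ∈ Icc 0 τ, ψ t ∈ X := by
  obtain ⟨T, hT0, hT⟩ : ∃ T : ℝ, 0 ≤ T ∧ 1 < (1 - u x₀) * Real.exp (k * α * T) := by
    have h1 : Tendsto (fun T : ℝ => (1 - u x₀) * Real.exp (k * α * T)) atTop atTop :=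
      (Real.tendsto_exp_atTop.comp (tendsto_id.const_mul_atTop (mul_pos hk hα))).const_mul_atTop
        (by linarith)
    exact ((eventually_ge_atTop 0).and (h1.eventually_gt_atTop 1)).exists
  refine ⟨T, fun F hF hFf d hd ψ hψ => ?_⟩
  have h0 : ψ 0 = x₀ := by simpa using hψ.2 0 ⟨le_rfl, hT0⟩
  have hdecay : ∀ b ≤ T, (∀ t ∈ Ico 0 b, ψ t ∉ Xinf) → (∀ t ∈ Ico 0 b, ψ t ∈ X ∩ {x | u x < 1}) →
      ∀ t ∈ Icc 0 b, u (ψ t) - 1 ≤ (u x₀ - 1) * Real.exp (k * α * t) := by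
    intro b hb hout hin
    have hsub : Icc 0 b ⊆ Icc 0 T := Icc_subset_Icc_right hb
    rw [← h0]
    refine IsTrajOn.sub_one_le_mul_exp hF hD hd
      ⟨hψ.1.mono hsub, fun t ht => hψ.2 t (hsub ht)⟩ hu hk.le (fun t ht e he => ?_)
      (fun t ht => hq _ (hout t ht)) fun t ht => (hin t ht).2
    have hB : ψ t ∈ B := hXB (subset_closure (hin t ht).1)
    rw [hFf _ hB e he]
    exact hdecr _ ⟨hB, hout t ht⟩ e he
  have hstay : ∀ b ≤ T, (∀ t ∈ Ico 0 b, ψ t ∉ Xinf) →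
      ∀ t ∈ Icc 0 b, ψ t ∈ X ∩ {x | u x < 1} := by
    intro b hb hout
    refine mapsTo_Icc_of_first_exit (hψ.1.mono (Icc_subset_Icc_right hb))
      (hX.inter (isOpen_lt hu.continuous continuous_const)) fun t ht hin => ?_
    have hlt : u (ψ t) < 1 := by
      have h1 := hdecay t (ht.2.trans hb) (fun s hs => hout s ⟨hs.1, hs.2.trans_le ht.2⟩) hin t
        ⟨ht.1, le_rfl⟩
      have h2 := mul_neg_of_neg_of_pos (sub_neg.2 hux₀) (Real.exp_pos (k * α * t))
      linarith
    have hB : ψ t ∈ B := by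
      rcases ht.1.eq_or_lt with rfl | hpos
      · rwa [h0]
      · refine hXB (((hψ.1 t ⟨ht.1, ht.2.trans hb⟩).mono (s := Ico 0 t) fun s hs =>
          ⟨hs.1, hs.2.le.trans (ht.2.trans hb)⟩).mem_closure ?_ fun s hs => (hin s hs).1)
        rw [closure_Ico hpos.ne]
        exact ⟨ht.1, le_rfl⟩
    refine ⟨?_, hlt⟩
    by_contra hnX
    exact absurd hlt (not_lt.2 (hu1 _ ⟨hB, hnX⟩))
  by_cases hhit : ∀ t ∈ Ico 0 T, ψ t ∉ Xinf
  · have hin := hstay T le_rfl hhit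
    refine ⟨T, ⟨hT0, le_rfl⟩, ?_, fun t ht => (hin t ht).1⟩
    by_contra hTX
    have h1 := hdecay T le_rfl hhit (fun t ht => hin t ⟨ht.1, ht.2.le⟩) T ⟨hT0, le_rfl⟩
    have h2 := hu0 _ ⟨(hin T ⟨hT0, le_rfl⟩).1, hTX⟩
    linarith
  · push Not at hhit
    obtain ⟨t₁, ht₁, ht₁X⟩ := hhit
    set S : Set ℝ := {t ∈ Ico 0 T | ψ t ∈ Xinf} with hS
    have hSne : S.Nonempty := ⟨t₁, ht₁, ht₁X⟩
    have hSb : BddBelow S := ⟨0, fun t ht => ht.1.1⟩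
    have hσ0 : 0 ≤ sInf S := le_csInf hSne fun t ht => ht.1.1
    have hσT : sInf S < T := (csInf_le hSb ⟨ht₁, ht₁X⟩).trans_lt ht₁.2
    have hin := hstay (sInf S) hσT.le fun t ht htX =>
      absurd (csInf_le hSb ⟨⟨ht.1, ht.2.trans hσT⟩, htX⟩) (not_le.2 ht.2)
    have hcont : Tendsto ψ (𝓝[≥] (sInf S)) (𝓝 (ψ (sInf S))) :=
      (hψ.1 _ ⟨hσ0, hσT.le⟩).mono_left (nhdsWithin_le_of_mem (mem_of_superset
        (Ico_mem_nhdsGE hσT) fun z hz => ⟨hσ0.trans hz.1, hz.2.le⟩))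
    obtain ⟨w, hw, hsub⟩ := mem_nhdsGE_iff_exists_Ico_subset.1
      (hcont (hX.mem_nhds (hin _ ⟨hσ0, le_rfl⟩).1))
    obtain ⟨τ, hτ, hτw⟩ := exists_lt_of_csInf_lt hSne hw
    refine ⟨τ, ⟨hτ.1.1, hτ.1.2.le⟩, hτ.2, fun t ht => ?_⟩
    rcases le_total t (sInf S) with h | h
    · exact (hin t ⟨ht.1, h⟩).1
    · exact hsub ⟨h, ht.2.trans_lt hτw⟩

/-- Theorem: if u solves the relaxed Zubov system on B̄ ∖ X∞, then
Ω = {x ∈ B̄ : u(x) < 1} is a robust domain of attraction (Ω ⊆ R). -/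
theorem statement_0
    {n m nX : ℕ} (hnX : 0 < nX)
    (f : Eu n → Eu m → Eu n) (hfpoly : IsPolyMap f)
    (D : Set (Eu m)) (hD : IsCompact D)
    (h : Fin nX → Eu n → ℝ) (hhpoly : ∀ j, IsPolyFun (h j))
    (hhnn : ∀ j x, 0 ≤ h j x) (hh0 : ∀ j, h j (0 : Eu n) = 0)
    (X : Set (Eu n)) (hXdef : X = {x | ∀ j, h j x < 1})
    (hXbdd : Bornology.IsBounded X)
    (α : ℝ) (hα : 0 < α) (s : ℕ) (hs : 2 ≤ s)
    (q : Eu n → ℝ) (hqpoly : IsPolyFun q) (hqnn : ∀ x, 0 ≤ q x)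
    (hq0 : q (0 : Eu n) = 0) (hqpos : ∀ x : Eu n, x ≠ 0 → 0 < q x)
    (Xinf : Set (Eu n)) (hXinfdef : Xinf = {x | q x < α})
    (hXinfbdd : Bornology.IsBounded Xinf)
    (Rad : ℝ) (hRad : 0 < Rad) (Bbar : Set (Eu n))
    (hBbar : Bbar = Metric.closedBall (0 : Eu n) Rad)
    (hXB : closure X ⊆ Metric.ball (0 : Eu n) Rad)
    (h0Xinf : (0 : Eu n) ∈ Xinf) (hXinfX : closure Xinf ⊆ X)
    (hattr : ∀ x₀ ∈ Xinf, ∀ d, IsAdmissible D d →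
      (∃ ψ', IsTrajOn f x₀ d (Ici 0) ψ') ∧
      ∀ ψ', IsTrajOn f x₀ d (Ici 0) ψ' →
        (∀ t : ℝ, 0 ≤ t → ψ' t ∈ X) ∧ Tendsto ψ' atTop (nhds (0 : Eu n)))
    (δ : ℕ) (hδodd : Odd δ) (hδpos : 0 < δ)
    (u : Eu n → ℝ) (hu : ContDiff ℝ 1 u)
    (hc1 : ∀ x ∈ Bbar \ Xinf, ∀ d ∈ D,
      0 ≤ -(fderiv ℝ u x (f x d)) - (δ : ℝ) * q x * (1 - u x))
    (hc2 : ∀ j : Fin nX, ∀ x ∈ closure X \ Xinf, 0 ≤ u x + (1 - h j x) ^ δ - 1)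
    (hc3 : ∀ x ∈ Bbar \ X, 0 ≤ u x - 1)
 :
    ∀ x₀ ∈ {x ∈ Bbar | u x < 1}, ∀ d, IsAdmissible D d →
      (∃ ψ', IsTrajOn f x₀ d (Ici 0) ψ') ∧
      ∀ ψ', IsTrajOn f x₀ d (Ici 0) ψ' →
        (∀ t : ℝ, 0 ≤ t → ψ' t ∈ X) ∧ Tendsto ψ' atTop (nhds (0 : Eu n)) := by
  have hfC := hfpoly.contDiff
  have hXopen : IsOpen X := by
    rw [hXdef, ← iInter_ofPred]
    exact isOpen_iInter_of_finite fun j => isOpen_lt (hhpoly j).continuous continuous_const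
  have hXBbar : closure X ⊆ Bbar := hBbar ▸ hXB.trans ball_subset_closedBall
  have hBbdd : Bornology.IsBounded Bbar := hBbar ▸ isBounded_closedBall
  have hδ : (0 : ℝ) < δ := by exact_mod_cast hδpos
  have hu0 : ∀ x ∈ X \ Xinf, 0 ≤ u x := by
    intro x hx
    have h1 := hc2 ⟨0, hnX⟩ x ⟨subset_closure hx.1, hx.2⟩
    have h2 : h ⟨0, hnX⟩ x < 1 := by
      have := hx.1
      rw [hXdef] at this
      exact this _
    have h3 : (1 - h ⟨0, hnX⟩ x) ^ δ ≤ 1 :=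
      pow_le_one₀ (by linarith) (by linarith [hhnn ⟨0, hnX⟩ x])
    linarith
  have hqα : ∀ x, x ∉ Xinf → α ≤ q x := by
    intro x hx
    rw [hXinfdef] at hx
    exact not_lt.1 hx
  rintro x₀ ⟨hx₀, hux₀⟩ d hd
  obtain ⟨T, hreach⟩ := exists_time_forall_hits hD hXopen hXBbar hu hδ hα hc1
    hqα hu0 (fun x hx => by linarith [hc3 x hx]) hx₀ hux₀
  refine ⟨?_, fun ψ hψ => ?_⟩
  · obtain ⟨F, ⟨K, hFK⟩, hFf⟩ := exists_lipschitzWith_eqOn hfC hBbdd hD.isBounded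
    obtain ⟨ψ, hψ⟩ := exists_isTrajOn_Icc hFK hD T x₀ hd
    obtain ⟨τ, hτ, hψτ, hψX⟩ := hreach F hFK.continuous hFf d hd ψ hψ
    obtain ⟨φ, hφ⟩ := (hattr (ψ τ) hψτ _ (hd.shift τ)).1
    have hψf : IsTrajOn f x₀ d (Icc 0 τ) ψ := by
      refine ⟨hψ.1.mono (Icc_subset_Icc_right hτ.2), fun t ht => ?_⟩
      rw [hψ.2 t ⟨ht.1, ht.2.trans hτ.2⟩]
      congr 1
      refine intervalIntegral.integral_congr fun r hr => ?_
      rw [uIcc_of_le ht.1] at hr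
      exact hFf _ (hXBbar (subset_closure (hψX r ⟨hr.1, hr.2.trans ht.2⟩))) _ (hd.2 r)
    refine ⟨fun t => if t ≤ τ then ψ t else φ (t - τ), isTrajOn_Ici_iff.2 fun b hb => ?_⟩
    have hcat := hψf.concat hfC.continuous hD hd hτ.1 hb (isTrajOn_Ici_iff.1 hφ b hb)
    have hsub : Icc 0 b ⊆ Icc 0 (τ + b) := Icc_subset_Icc_right (by linarith [hτ.1])
    exact ⟨hcat.1.mono hsub, fun t ht => hcat.2 t (hsub ht)⟩
  · obtain ⟨τ, hτ, hψτ, hψX⟩ := hreach f hfC.continuous (fun _ _ _ _ => rfl) d hd ψ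
      ⟨hψ.1.mono Icc_subset_Ici_self, fun t ht => hψ.2 t ht.1⟩
    obtain ⟨hX, hlim⟩ := (hattr (ψ τ) hψτ _ (hd.shift τ)).2 _
      (hψ.shift hfC.continuous hD hd hτ.1)
    refine ⟨fun t ht => ?_, ?_⟩
    · rcases le_total t τ with h | h
      · exact hψX t ⟨ht, h⟩
      · simpa using hX (t - τ) (by linarith)
    · have := hlim.comp (tendsto_atTop_add_const_right atTop (-τ) tendsto_id)
      simpa [Function.comp_def] using this
end
end

section
/- Let (ε_k) be a sequence of positive reals with ε_k → 0 and let (p_k) be a sequence of continuous functions p_k : ℝ^n → ℝ with 0 ≤ p_k(x) − v(x) < ε_k for all x ∈ B̄ and all k; set R_{k,0} := {x ∈ B̄ : p_k(x) < 1}. Assume v is continuous and the interior of R equals {x ∈ ℝ^n : v(x) < 1} and is contained in B̄. Then the Lebesgue measure of interior(R) ∖ R_{k,0} tends to 0 as k → ∞, i.e. the sets R_{k,0} converge from inside in measure to the interior of the maximal robust domain of attraction. -/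
open MeasureTheory Metric Set Filter Topology

open scoped ENNReal NNReal

attribute [local instance] Classical.propDecidable

noncomputable section

/-- If continuous functions `p k` converge to `v` pointwise on a set `K` of finite measure that
contains `{v < c}`, then `{x ∈ K | p k x < c}` exhausts `{v < c}` in measure. -/
theorem tendsto_measure_diff_sublevel {E : Type*} [TopologicalSpace E] [MeasurableSpace E]
    [OpensMeasurableSpace E] {μ : Measure E} {K : Set E} (hK : MeasurableSet K) (hμK : μ K ≠ ∞)
    {v : E → ℝ} (hv : Continuous v) {c : ℝ} (hsub : {x | v x < c} ⊆ K)
    {p : ℕ → E → ℝ} (hp : ∀ k, Continuous (p k))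
    (hpv : ∀ x ∈ K, Tendsto (fun k => p k x) atTop (𝓝 (v x))) :
    Tendsto (fun k => μ ({x | v x < c} \ {x ∈ K | p k x < c})) atTop (𝓝 0) := by
  have hmeas : ∀ k, MeasurableSet ({x | v x < c} \ {x ∈ K | p k x < c}) := fun k =>
    (isOpen_lt hv continuous_const).measurableSet.diff
      (hK.inter (isOpen_lt (hp k) continuous_const).measurableSet)
  rw [← measure_empty (μ := μ)]
  refine tendsto_measure_of_tendsto_indicator atTop hmeas hK hμK
    (Eventually.of_forall fun k => sdiff_subset.trans hsub) fun x => ?_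
  by_cases hx : v x < c
  · filter_upwards [(hpv x (hsub hx)).eventually_lt_const hx] with k hk
    simp [hx, hk, hsub hx]
  · simp [hx]

/-- Inner convergence in Lebesgue measure of the sublevel sets R_{k,0}
to the interior of the maximal robust domain of attraction. -/
theorem statement_5
    {n m nX : ℕ} (hnX : 0 < nX)
    (f : Eu n → Eu m → Eu n) (hfpoly : IsPolyMap f)
    (D : Set (Eu m)) (hD : IsCompact D)
    (h : Fin nX → Eu n → ℝ) (hhpoly : ∀ j, IsPolyFun (h j))
    (hhnn : ∀ j x, 0 ≤ h j x) (hh0 : ∀ j, h j (0 : Eu n) = 0)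
    (X : Set (Eu n)) (hXdef : X = {x | ∀ j, h j x < 1})
    (hXbdd : Bornology.IsBounded X)
    (α : ℝ) (hα : 0 < α) (s : ℕ) (hs : 2 ≤ s)
    (q : Eu n → ℝ) (hqpoly : IsPolyFun q) (hqnn : ∀ x, 0 ≤ q x)
    (hq0 : q (0 : Eu n) = 0) (hqpos : ∀ x : Eu n, x ≠ 0 → 0 < q x)
    (Xinf : Set (Eu n)) (hXinfdef : Xinf = {x | q x < α})
    (hXinfbdd : Bornology.IsBounded Xinf)
    (g : Eu n → ℝ)
    (hgdef : ∀ x, g x =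
      if x ∈ Xinf then α - α * Real.exp (-(‖x‖ ^ s / infDist x Xinfᶜ)) else q x)
    (Rad : ℝ) (hRad : 0 < Rad) (Bbar : Set (Eu n))
    (hBbar : Bbar = Metric.closedBall (0 : Eu n) Rad)
    (hXB : closure X ⊆ Metric.ball (0 : Eu n) Rad)
    (Lf : ℝ) (hLf : 0 < Lf) (F : Eu n → Eu m → Eu n)
    (hFcont : ContinuousOn (fun p : Eu n × Eu m => F p.1 p.2) (univ ×ˢ D))
    (hFf : ∀ x ∈ Bbar, ∀ d ∈ D, F x d = f x d)
    (hFlip : ∀ d ∈ D, ∀ x₁ x₂ : Eu n, ‖F x₁ d - F x₂ d‖ ≤ Lf * ‖x₁ - x₂‖)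
    (ψ : Eu n → (ℝ → Eu m) → ℝ → Eu n)
    (hψ : ∀ x d, IsAdmissible D d →
      IsTrajOn F x d (Ici 0) (ψ x d) ∧
      ∀ φ, IsTrajOn F x d (Ici 0) φ → ∀ t ∈ Ici (0:ℝ), φ t = ψ x d t)
    (δ : ℝ) (hδ : 0 < δ) (v : Eu n → ℝ)
    (hvdef : ∀ x, v x = sSup {r : ℝ | ∃ d, IsAdmissible D d ∧ ∃ t : ℝ, 0 ≤ t ∧
      r = 1 - (⨅ j, max (1 - h j (ψ x d t)) 0) ^ δ *
        Real.exp (-(δ * (∫ τ in (0:ℝ)..t, g (ψ x d τ))))})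
    (Rset : Set (Eu n))
    (hRdef : Rset = {x₀ | ∀ d, IsAdmissible D d →
      (∃ ψ', IsTrajOn f x₀ d (Ici 0) ψ') ∧
      ∀ ψ', IsTrajOn f x₀ d (Ici 0) ψ' →
        (∀ t : ℝ, 0 ≤ t → ψ' t ∈ X) ∧ Tendsto ψ' atTop (nhds (0 : Eu n))})
    (hvcont : Continuous v)
    (hIntR : interior Rset = {x : Eu n | v x < 1})
    (hRB : interior Rset ⊆ Bbar)
    (ε : ℕ → ℝ) (hεpos : ∀ k, 0 < ε k) (hεlim : Tendsto ε atTop (nhds 0))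
    (p : ℕ → Eu n → ℝ) (hpc : ∀ k, Continuous (p k))
    (hpv : ∀ k, ∀ x ∈ Bbar, 0 ≤ p k x - v x ∧ p k x - v x < ε k) :
    Tendsto (fun k => volume (interior Rset \ {x ∈ Bbar | p k x < 1}))
      atTop (nhds 0) := by
  rw [hIntR] at hRB ⊢
  have hB : IsCompact Bbar := hBbar ▸ isCompact_closedBall 0 Rad
  refine tendsto_measure_diff_sublevel hB.measurableSet hB.measure_ne_top hvcont hRB hpc
    fun x hx => ?_
  refine tendsto_sub_nhds_zero_iff.mp ?_
  exact squeeze_zero (fun k => (hpv k x hx).1) (fun k => (hpv k x hx).2.le) hεlim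
end
end

section
/- The function g is locally Lipschitz continuous on ℝ^n: every point of ℝ^n has a neighborhood on which g is Lipschitz continuous. -/
open MeasureTheory Metric Set Filter Topology

open scoped ENNReal NNReal

attribute [local instance] Classical.propDecidable

noncomputable section

/-- A function that agrees near `x` with `Ψ ∘ u`, where `u` is locally Lipschitz and `Ψ` is `C¹` at
`u x`, is Lipschitz near `x`. -/
theorem exists_lipschitzOnWith_of_eventuallyEq_comp {X F : Type*} [PseudoMetricSpace X]
    [NormedAddCommGroup F] [NormedSpace ℝ F] {f : X → ℝ} {u : X → F} {Ψ : F → ℝ} {x : X}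
    (hu : LocallyLipschitz u) (hΨ : ContDiffAt ℝ 1 Ψ (u x)) (hf : f =ᶠ[𝓝 x] Ψ ∘ u) :
    ∃ K, ∃ t ∈ 𝓝 x, LipschitzOnWith K f t := by
  obtain ⟨K, t, ht, hK⟩ := hΨ.exists_lipschitzOnWith
  obtain ⟨L, v, hv, hL⟩ := hu x
  refine ⟨K * L, {y | f y = (Ψ ∘ u) y} ∩ (v ∩ u ⁻¹' t),
    inter_mem hf (inter_mem hv (hu.continuous.continuousAt ht)), ?_⟩
  have hcomp : LipschitzOnWith (K * L) (Ψ ∘ u) (v ∩ u ⁻¹' t) :=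
    hK.comp (hL.mono inter_subset_left) fun y hy => hy.2
  intro y hy z hz
  rw [hy.1, hz.1]
  exact hcomp hy.2 hz.2

/-- On an open neighbourhood `U ≠ univ` of the origin, `exp (-‖x‖ ^ s / dist (x, Uᶜ))`, extended by
zero, is locally Lipschitz. -/
theorem locallyLipschitz_exp_neg_norm_pow_div_infDist {E : Type*} [NormedAddCommGroup E]
    {U : Set E} (hU : IsOpen U) (h0 : (0 : E) ∈ U) (hne : Uᶜ.Nonempty) (s : ℕ) :
    LocallyLipschitz fun x : E =>
      if x ∈ U then Real.exp (-(‖x‖ ^ s / infDist x Uᶜ)) else 0 := by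
  have hpos : ∀ x ∈ U, 0 < infDist x Uᶜ := fun x hx =>
    (hU.isClosed_compl.notMem_iff_infDist_pos hne).1 fun h => h hx
  have hu : LocallyLipschitz fun x : E => (‖x‖, infDist x Uᶜ) :=
    lipschitzWith_one_norm.locallyLipschitz.prodMk (lipschitz_infDist_pt Uᶜ).locallyLipschitz
  intro x
  by_cases hx : x = 0
  · subst hx
    refine exists_lipschitzOnWith_of_eventuallyEq_comp
      (Ψ := fun p : ℝ × ℝ => Real.exp (-(p.1 ^ s / p.2))) hu ?_ ?_
    · exact ((contDiffAt_fst.pow s).div contDiffAt_snd (hpos 0 h0).ne').neg.exp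
    · filter_upwards [hU.mem_nhds h0] with y hy
      simp [hy]
  · refine exists_lipschitzOnWith_of_eventuallyEq_comp
      (Ψ := fun p : ℝ × ℝ => expNegInvGlue (p.2 / p.1 ^ s)) hu ?_ ?_
    · exact (expNegInvGlue.contDiff (n := 1)).contDiffAt.comp (‖x‖, infDist x Uᶜ)
        (contDiffAt_snd.div (contDiffAt_fst.pow s) (pow_ne_zero s (norm_ne_zero_iff.2 hx)))
    · filter_upwards [isOpen_ne.mem_nhds hx] with y hy
      by_cases hyU : y ∈ U
      · have hdiv : 0 < infDist y Uᶜ / ‖y‖ ^ s :=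
          div_pos (hpos y hyU) (pow_pos (norm_pos_iff.2 hy) s)
        simp [hyU, expNegInvGlue, hdiv.not_ge]
      · simp [hyU, infDist_zero_of_mem (show y ∈ Uᶜ from hyU), expNegInvGlue.zero]

theorem IsPolyFun.contDiff {n : ℕ} {q : Eu n → ℝ} (hq : IsPolyFun q) : ContDiff ℝ 1 q := by
  obtain ⟨p, hp⟩ := hq
  rw [funext hp]
  have hproj : ∀ i, ContDiff ℝ 1 fun x : Eu n => x i := fun i => by fun_prop
  induction p using MvPolynomial.induction_on generalizing q with
  | C a => simpa using contDiff_const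
  | add p₁ p₂ h₁ h₂ => simpa using (h₁ fun _ => rfl).add (h₂ fun _ => rfl)
  | mul_X p i h => simpa using (h fun _ => rfl).mul (hproj i)

/-- g is locally Lipschitz continuous on ℝ^n. -/
theorem statement_10
    {n : ℕ}
    (α : ℝ) (hα : 0 < α) (s : ℕ) (hs : 2 ≤ s)
    (q : Eu n → ℝ) (hqpoly : IsPolyFun q) (hqnn : ∀ x, 0 ≤ q x)
    (hq0 : q (0 : Eu n) = 0) (hqpos : ∀ x : Eu n, x ≠ 0 → 0 < q x)
    (Xinf : Set (Eu n)) (hXinfdef : Xinf = {x | q x < α})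
    (hXinfbdd : Bornology.IsBounded Xinf)
    (g : Eu n → ℝ)
    (hgdef : ∀ x, g x =
      if x ∈ Xinf then α - α * Real.exp (-(‖x‖ ^ s / infDist x Xinfᶜ)) else q x)
 :
    LocallyLipschitz g := by
  have hq := hqpoly.contDiff
  have hU : IsOpen Xinf := hXinfdef ▸ isOpen_lt hq.continuous continuous_const
  have h0 : (0 : Eu n) ∈ Xinf := by simp [hXinfdef, hq0, hα]
  rcases Xinfᶜ.eq_empty_or_nonempty with hempty | hne
  · have hg : g = fun _ => 0 := by
      funext x
      simp [hgdef, compl_empty_iff.1 hempty]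
    exact hg ▸ LocallyLipschitz.const 0
  · have hE := locallyLipschitz_exp_neg_norm_pow_div_infDist hU h0 hne s
    have hαE := (contDiff_const.mul contDiff_id : ContDiff ℝ 1 fun y : ℝ => α * y).locallyLipschitz
      |>.comp hE
    have hg : g = fun x => max (q x) α -
        α * (if x ∈ Xinf then Real.exp (-(‖x‖ ^ s / infDist x Xinfᶜ)) else 0) := by
      funext x
      by_cases hx : x ∈ Xinf
      · have hqx : q x < α := by simpa [hXinfdef] using hx
        simp [hgdef, hx, max_eq_right hqx.le]
      · have hqx : α ≤ q x := by simpa [hXinfdef] using hx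
        simp [hgdef, hx, max_eq_left hqx]
    rw [hg]
    exact (hq.locallyLipschitz.max_const α).sub hαE
end
end

section
/- Let r̄ > 0 be such that the closed ball B̄(0,r̄) is contained in X∞. Then there exists a constant K > 0 such that for all x, y ∈ B̄(0,r̄): |g(x) − g(y)| ≤ K · max{‖x‖^s, ‖y‖^s, ‖x‖^{s−2}, ‖y‖^{s−2}} · ‖x − y‖. -/
open MeasureTheory Metric Set Filter Topology

open scoped ENNReal NNReal

attribute [local instance] Classical.propDecidable

noncomputable section

theorem exp_neg_sub_exp_neg_le {u v : ℝ} (hu : 0 ≤ u) (huv : u ≤ v) :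
    Real.exp (-u) - Real.exp (-v) ≤ v - u := by
  have h1 : Real.exp (-v) = Real.exp (-u) * Real.exp (-(v - u)) := by
    rw [← Real.exp_add]; ring_nf
  have h2 := Real.one_sub_le_exp_neg (v - u)
  have h3 : Real.exp (-u) ≤ 1 := Real.exp_le_one_iff.2 (by linarith)
  have h4 := Real.exp_pos (-u)
  rw [h1]
  nlinarith [mul_le_mul_of_nonneg_left h2 h4.le,
    mul_le_mul_of_nonneg_right h3 (sub_nonneg.2 huv)]

theorem abs_exp_neg_sub_exp_neg_le {u v : ℝ} (hu : 0 ≤ u) (hv : 0 ≤ v) :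
    |Real.exp (-u) - Real.exp (-v)| ≤ |u - v| := by
  rcases le_total u v with h | h
  · rw [abs_sub_comm u v, abs_of_nonneg (sub_nonneg.2 h),
      abs_of_nonneg (sub_nonneg.2 (Real.exp_le_exp.2 (neg_le_neg h)))]
    exact exp_neg_sub_exp_neg_le hu h
  · rw [abs_sub_comm, abs_of_nonneg (sub_nonneg.2 h),
      abs_of_nonneg (sub_nonneg.2 (Real.exp_le_exp.2 (neg_le_neg h)))]
    exact exp_neg_sub_exp_neg_le hv h

theorem abs_div_sub_div_le {a b c d δ : ℝ} (hb : 0 ≤ b) (hδ : 0 < δ) (hc : δ ≤ c)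
    (hd : δ ≤ d) : |a / c - b / d| ≤ |a - b| / δ + b * |c - d| / δ ^ 2 := by
  have hc0 : 0 < c := hδ.trans_le hc
  have hd0 : 0 < d := hδ.trans_le hd
  have h : a / c - b / d = (a - b) / c + b * (d - c) / (c * d) := by
    field_simp
    ring
  rw [h]
  refine (abs_add_le _ _).trans ?_
  rw [abs_div, abs_div, abs_mul, abs_of_pos hc0, abs_of_nonneg hb, abs_of_pos (mul_pos hc0 hd0),
    abs_sub_comm d c, sq]
  gcongr

theorem norm_pow_sub_norm_pow_le {E : Type*} [SeminormedAddCommGroup E] {x y : E} {r : ℝ} {s : ℕ}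
    (hs : 2 ≤ s) (hx : ‖x‖ ≤ r) (hy : ‖y‖ ≤ r) :
    |‖x‖ ^ s - ‖y‖ ^ s| ≤ s * r * max (‖x‖ ^ (s - 2)) (‖y‖ ^ (s - 2)) * ‖x - y‖ := by
  obtain ⟨k, rfl⟩ := Nat.exists_eq_add_of_le' hs
  have hM : max ‖x‖ ‖y‖ ^ k ≤ max (‖x‖ ^ k) (‖y‖ ^ k) := by
    rcases le_total ‖x‖ ‖y‖ with h | h <;> simp [h]
  have h := abs_pow_sub_pow_le ‖x‖ ‖y‖ (k + 2)
  rw [abs_norm, abs_norm] at h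
  calc _ ≤ _ := h
    _ = |‖x‖ - ‖y‖| * (k + 2 : ℕ) * (max ‖x‖ ‖y‖ ^ k * max ‖x‖ ‖y‖) := by
        rw [← pow_succ]; rfl
    _ ≤ ‖x - y‖ * (k + 2 : ℕ) * (max (‖x‖ ^ k) (‖y‖ ^ k) * r) := by
        gcongr
        · exact abs_norm_sub_norm_le x y
        · exact max_le hx hy
    _ = _ := by
        rw [Nat.add_sub_cancel]; ring

theorem exists_pos_le_infDist {X : Type*} [PseudoMetricSpace X] {B S : Set X}
    (hB : IsCompact B) (hS : IsClosed S) (hne : S.Nonempty) (hBS : Disjoint B S) :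
    ∃ δ > 0, ∀ x ∈ B, δ ≤ infDist x S :=
  hB.exists_forall_le' (continuous_infDist_pt S).continuousOn fun _ hx =>
    (hS.notMem_iff_infDist_pos hne).1 (Set.disjoint_left.1 hBS hx)

/-- Quantitative Lipschitz-type bound for g on a small ball around the origin. -/
theorem statement_11
    {n : ℕ}
    (α : ℝ) (hα : 0 < α) (s : ℕ) (hs : 2 ≤ s)
    (q : Eu n → ℝ) (hqpoly : IsPolyFun q) (hqnn : ∀ x, 0 ≤ q x)
    (hq0 : q (0 : Eu n) = 0) (hqpos : ∀ x : Eu n, x ≠ 0 → 0 < q x)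
    (Xinf : Set (Eu n)) (hXinfdef : Xinf = {x | q x < α})
    (hXinfbdd : Bornology.IsBounded Xinf)
    (g : Eu n → ℝ)
    (hgdef : ∀ x, g x =
      if x ∈ Xinf then α - α * Real.exp (-(‖x‖ ^ s / infDist x Xinfᶜ)) else q x)
    (rb : ℝ) (hrb : 0 < rb)
    (hball : Metric.closedBall (0 : Eu n) rb ⊆ Xinf) :
    ∃ K : ℝ, 0 < K ∧
      ∀ x ∈ Metric.closedBall (0 : Eu n) rb, ∀ y ∈ Metric.closedBall (0 : Eu n) rb,
        |g x - g y| ≤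
          K * max (max (‖x‖ ^ s) (‖y‖ ^ s)) (max (‖x‖ ^ (s - 2)) (‖y‖ ^ (s - 2)))
            * ‖x - y‖ := by
  have hopen : IsOpen Xinf := hXinfdef ▸ isOpen_lt hqpoly.continuous continuous_const
  have hg : ∀ x ∈ closedBall (0 : Eu n) rb,
      g x = α - α * Real.exp (-(‖x‖ ^ s / infDist x Xinfᶜ)) := fun x hx => by
    rw [hgdef, if_pos (hball hx)]
  rcases Xinfᶜ.eq_empty_or_nonempty with hemp | hne
  · refine ⟨1, one_pos, fun x hx y hy => ?_⟩
    rw [hg x hx, hg y hy, hemp]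
    simp only [infDist_empty, div_zero, sub_self, abs_zero]
    positivity
  obtain ⟨δ, hδ, hle⟩ := exists_pos_le_infDist (isCompact_closedBall (0 : Eu n) rb)
    hopen.isClosed_compl hne (Set.disjoint_compl_right_iff_subset.2 hball)
  refine ⟨α * (s * rb / δ + 1 / δ ^ 2), by positivity, fun x hx y hy => ?_⟩
  rw [hg x hx, hg y hy]
  have hpow := norm_pow_sub_norm_pow_le hs (mem_closedBall_zero_iff.1 hx)
    (mem_closedBall_zero_iff.1 hy)
  have hdist : |infDist x Xinfᶜ - infDist y Xinfᶜ| ≤ ‖x - y‖ := by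
    rw [← dist_eq_norm, ← Real.dist_eq]
    simpa using (lipschitz_infDist_pt Xinfᶜ).dist_le_mul x y
  set M := max (max (‖x‖ ^ s) (‖y‖ ^ s)) (max (‖x‖ ^ (s - 2)) (‖y‖ ^ (s - 2)))
  have hyM : ‖y‖ ^ s ≤ M := (le_max_right _ _).trans (le_max_left _ _)
  have hM2 : max (‖x‖ ^ (s - 2)) (‖y‖ ^ (s - 2)) ≤ M := le_max_right _ _
  set u := ‖x‖ ^ s / infDist x Xinfᶜ
  set v := ‖y‖ ^ s / infDist y Xinfᶜ
  have hu0 : 0 ≤ u := div_nonneg (by positivity) infDist_nonneg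
  have hv0 : 0 ≤ v := div_nonneg (by positivity) infDist_nonneg
  calc |α - α * Real.exp (-u) - (α - α * Real.exp (-v))|
      = α * |Real.exp (-v) - Real.exp (-u)| := by
        rw [← abs_of_pos hα, ← abs_mul, abs_of_pos hα]; ring_nf
    _ ≤ α * |u - v| := by
        rw [abs_sub_comm u v]
        exact mul_le_mul_of_nonneg_left (abs_exp_neg_sub_exp_neg_le hv0 hu0) hα.le
    _ ≤ α * (|‖x‖ ^ s - ‖y‖ ^ s| / δ +
          ‖y‖ ^ s * |infDist x Xinfᶜ - infDist y Xinfᶜ| / δ ^ 2) := by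
        gcongr
        exact abs_div_sub_div_le (by positivity) hδ (hle x hx) (hle y hy)
    _ ≤ α * (s * rb * M * ‖x - y‖ / δ + M * ‖x - y‖ / δ ^ 2) := by
        gcongr
        exact hpow.trans (by gcongr)
    _ = α * (s * rb / δ + 1 / δ ^ 2) * M * ‖x - y‖ := by ring
end
end

section
/- The function g satisfies: g(x) ≥ 0 for all x ∈ ℝ^n, g(0) = 0, and for every c > 0 one has inf{ g(x) : x ∈ ℝ^n, ‖x‖ ≥ c } > 0. -/
open MeasureTheory Metric Set Filter Topology

open scoped ENNReal NNReal

attribute [local instance] Classical.propDecidable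

noncomputable section

/-- g is nonnegative, vanishes at 0, and is bounded away from 0 outside
every ball around the origin. -/
theorem statement_12
    {n : ℕ}
    (α : ℝ) (hα : 0 < α) (s : ℕ) (hs : 2 ≤ s)
    (q : Eu n → ℝ) (hqpoly : IsPolyFun q) (hqnn : ∀ x, 0 ≤ q x)
    (hq0 : q (0 : Eu n) = 0) (hqpos : ∀ x : Eu n, x ≠ 0 → 0 < q x)
    (Xinf : Set (Eu n)) (hXinfdef : Xinf = {x | q x < α})
    (hXinfbdd : Bornology.IsBounded Xinf)
    (g : Eu n → ℝ)
    (hgdef : ∀ x, g x =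
      if x ∈ Xinf then α - α * Real.exp (-(‖x‖ ^ s / infDist x Xinfᶜ)) else q x)
    (hn : 0 < n) :
    (∀ x, 0 ≤ g x) ∧ g (0 : Eu n) = 0 ∧
      ∀ c : ℝ, 0 < c → 0 < sInf (g '' {x : Eu n | c ≤ ‖x‖}) := by
  have : NeZero n := ⟨hn.ne'⟩
  have hopen : IsOpen Xinf := by
    rw [hXinfdef]
    exact isOpen_lt hqpoly.continuous continuous_const
  have hne : Xinfᶜ.Nonempty := by
    rw [nonempty_compl]
    rintro rfl
    exact NormedSpace.unbounded_univ ℝ (Eu n) hXinfbdd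
  have hmem : ∀ x, x ∈ Xinf ↔ q x < α := by simp [hXinfdef]
  refine ⟨fun x => ?_, ?_, fun c hc => ?_⟩
  · rw [hgdef]
    split_ifs
    · have : Real.exp (-(‖x‖ ^ s / infDist x Xinfᶜ)) ≤ 1 := by
        rw [Real.exp_le_one_iff, neg_nonpos]
        exact div_nonneg (by positivity) infDist_nonneg
      nlinarith
    · exact hqnn x
  · rw [hgdef, if_pos ((hmem 0).2 (hq0 ▸ hα))]
    simp [show s ≠ 0 by lia]
  · obtain ⟨R, hR0, hR⟩ := hXinfbdd.exists_pos_norm_le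
    set M := infDist 0 Xinfᶜ + R
    have hM : 0 < M := add_pos_of_nonneg_of_pos infDist_nonneg hR0
    have hpos : 0 < α - α * Real.exp (-(c ^ s / M)) := by
      have : Real.exp (-(c ^ s / M)) < 1 := by
        rw [Real.exp_lt_one_iff, neg_lt_zero]
        positivity
      nlinarith
    refine hpos.trans_le (le_csInf ?_ ?_)
    · obtain ⟨x, hx⟩ := exists_norm_eq (Eu n) hc.le
      exact ⟨g x, x, hx.ge, rfl⟩
    · rintro _ ⟨x, hx : c ≤ ‖x‖, rfl⟩
      rw [hgdef]
      split_ifs with h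
      · have hd : 0 < infDist x Xinfᶜ :=
          (hopen.isClosed_compl.notMem_iff_infDist_pos hne).1 (by simpa using h)
        have hdM : infDist x Xinfᶜ ≤ M := by
          have := infDist_le_infDist_add_dist (s := Xinfᶜ) (x := x) (y := 0)
          rw [dist_zero_right] at this
          linarith [hR x h]
        gcongr
      · have hqx : α ≤ q x := not_lt.1 (fun hlt => h ((hmem x).2 hlt))
        nlinarith [Real.exp_pos (-(c ^ s / M))]
end
end

section
/- Let ψ : [0,∞) → ℝ^n be continuous, let g : ℝ^n → ℝ be continuous with g(x) ≥ 0 for all x and g(0) = 0, let T ≥ 0, and let S ⊆ ℝ^n be a set containing 0 and containing ψ(t) for all t ≥ T, on which g is Lipschitz continuous with constant L_g. Suppose there are constants C, σ, r̄ > 0 with ‖ψ(T)‖ ≤ r̄ and ‖ψ(T + t)‖ ≤ C e^{−σ t} ‖ψ(T)‖ for all t ≥ 0. Then ∫₀^∞ g(ψ(t)) dt ≤ M·T + L_g·C·r̄/σ, where M = sup_{t ∈ [0,T]} g(ψ(t)); in particular the integral ∫₀^∞ g(ψ(t)) dt is finite. -/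
open MeasureTheory Metric Set Filter Topology

open scoped ENNReal NNReal

attribute [local instance] Classical.propDecidable

noncomputable section

/-- Finiteness (with an explicit bound) of the integral of g along an
eventually exponentially decaying trajectory. -/
theorem statement_13
    {n : ℕ} (ψ : ℝ → Eu n) (hψ : ContinuousOn ψ (Ici 0))
    (g : Eu n → ℝ) (hg : Continuous g) (hgnn : ∀ x, 0 ≤ g x)
    (hg0 : g (0 : Eu n) = 0)
    (T : ℝ) (hT : 0 ≤ T) (S : Set (Eu n)) (h0S : (0 : Eu n) ∈ S)
    (hψS : ∀ t : ℝ, T ≤ t → ψ t ∈ S)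
    (Lg : ℝ) (hLgnn : 0 ≤ Lg)
    (hLg : ∀ x ∈ S, ∀ y ∈ S, |g x - g y| ≤ Lg * ‖x - y‖)
    (C σ rb : ℝ) (hC : 0 < C) (hσ : 0 < σ) (hrb : 0 < rb)
    (hψT : ‖ψ T‖ ≤ rb)
    (hdecay : ∀ t : ℝ, 0 ≤ t → ‖ψ (T + t)‖ ≤ C * Real.exp (-σ * t) * ‖ψ T‖)
    (M : ℝ) (hM : M = sSup ((fun t => g (ψ t)) '' Icc (0:ℝ) T)) :
    (∫⁻ t in Ici (0:ℝ), ENNReal.ofReal (g (ψ t))) ≤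
      ENNReal.ofReal (M * T + Lg * C * rb / σ) ∧
    (∫⁻ t in Ici (0:ℝ), ENNReal.ofReal (g (ψ t))) < ⊤ := by
  have hbdd : BddAbove ((fun t => g (ψ t)) '' Icc (0:ℝ) T) :=
    (isCompact_Icc.image_of_continuousOn
      (hg.comp_continuousOn (hψ.mono Icc_subset_Ici_self))).bddAbove
  have hle_M : ∀ t ∈ Icc (0:ℝ) T, g (ψ t) ≤ M := fun t ht =>
    hM ▸ le_csSup hbdd (mem_image_of_mem _ ht)
  have hM_nonneg : 0 ≤ M := (hgnn _).trans (hle_M 0 ⟨le_rfl, hT⟩)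
  have htail : ∀ s ∈ Ioi T,
      g (ψ s) ≤ Lg * C * rb * Real.exp (σ * T) * Real.exp (-σ * s) := by
    intro s hs
    have hs' : T ≤ s := le_of_lt hs
    have hlip := hLg _ (hψS s hs') _ h0S
    rw [hg0, sub_zero, sub_zero] at hlip
    have hdec := hdecay (s - T) (sub_nonneg.2 hs')
    rw [add_sub_cancel] at hdec
    calc g (ψ s) ≤ Lg * ‖ψ s‖ := (le_abs_self _).trans hlip
      _ ≤ Lg * (C * Real.exp (-σ * (s - T)) * rb) := by
        gcongr
        exact hdec.trans (by gcongr)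
      _ = Lg * C * rb * Real.exp (σ * T) * Real.exp (-σ * s) := by
        rw [show -σ * (s - T) = σ * T + -σ * s by ring, Real.exp_add]
        ring
  have hhead_int : ∫⁻ t in Icc (0:ℝ) T, ENNReal.ofReal (g (ψ t)) ≤ ENNReal.ofReal (M * T) :=
    calc ∫⁻ t in Icc (0:ℝ) T, ENNReal.ofReal (g (ψ t))
        ≤ ∫⁻ _ in Icc (0:ℝ) T, ENNReal.ofReal M :=
          setLIntegral_mono' measurableSet_Icc fun t ht => ENNReal.ofReal_le_ofReal (hle_M t ht)
      _ = ENNReal.ofReal (M * T) := by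
        rw [setLIntegral_const, Real.volume_Icc, sub_zero, ENNReal.ofReal_mul hM_nonneg]
  have htail_int : ∫⁻ t in Ioi T, ENNReal.ofReal (g (ψ t)) ≤
      ENNReal.ofReal (Lg * C * rb / σ) :=
    calc ∫⁻ t in Ioi T, ENNReal.ofReal (g (ψ t))
        ≤ ∫⁻ s in Ioi T,
            ENNReal.ofReal (Lg * C * rb * Real.exp (σ * T) * Real.exp (-σ * s)) :=
          setLIntegral_mono' measurableSet_Ioi fun t ht => ENNReal.ofReal_le_ofReal (htail t ht)
      _ = ENNReal.ofReal (Lg * C * rb / σ) := by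
        rw [← ofReal_integral_eq_lintegral_ofReal
          ((integrableOn_exp_mul_Ioi (neg_lt_zero.2 hσ) T).const_mul _)
          (ae_of_all _ fun s => by positivity), integral_const_mul,
          integral_exp_mul_Ioi (neg_lt_zero.2 hσ), neg_mul, Real.exp_neg]
        congr 1
        field_simp
  have hbound : ∫⁻ t in Ici (0:ℝ), ENNReal.ofReal (g (ψ t)) ≤
      ENNReal.ofReal (M * T + Lg * C * rb / σ) := by
    rw [← Icc_union_Ioi_eq_Ici hT, ENNReal.ofReal_add (by positivity) (by positivity)]
    exact (lintegral_union_le _ _ _).trans (add_le_add hhead_int htail_int)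
  exact ⟨hbound, hbound.trans_lt ENNReal.ofReal_lt_top⟩
end
end

section
/- Let D ⊂ ℝ^m be compact, F : ℝ^n × D → ℝ^n continuous, g : ℝ^n → ℝ continuous, u : ℝ^n → ℝ continuously differentiable, δ > 0, and τ > 0. Let d : [0,∞) → D be measurable and let ψ : [0,τ] → ℝ^n be continuous with ψ(t) = ψ(0) + ∫₀^t F(ψ(s), d(s)) ds for all t ∈ [0,τ]. Suppose S ⊆ ℝ^n is a set with ψ(t) ∈ S for all t ∈ [0,τ] and −∇u(x)·F(x,d') − δ·g(x)·(1 − u(x)) ≥ 0 for all x ∈ S and all d' ∈ D. Then u(ψ(0)) − 1 ≥ exp(−δ·G)·(u(ψ(τ)) − 1), where G = ∫₀^τ g(ψ(t)) dt. -/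
open MeasureTheory Metric Set Filter Topology

open scoped ENNReal NNReal

attribute [local instance] Classical.propDecidable

noncomputable section

/-- A real function that is absolutely continuous on `[a, b]` and whose derivative is almost
everywhere nonpositive there does not increase from `a` to `b`. -/
theorem AbsolutelyContinuousOnInterval.le_of_ae_deriv_nonpos {f : ℝ → ℝ} {a b : ℝ} (hab : a ≤ b)
    (hf : AbsolutelyContinuousOnInterval f a b)
    (hf' : ∀ᵐ t, t ∈ Icc a b → deriv f t ≤ 0) : f b ≤ f a := by
  have h : 0 ≤ ∫ t in a..b, -deriv f t :=
    intervalIntegral.integral_nonneg_of_ae_restrict hab <| by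
      rw [EventuallyLE, ae_restrict_iff' measurableSet_Icc]
      filter_upwards [hf'] with t ht hmem
      simpa using ht hmem
  rw [intervalIntegral.integral_neg, hf.integral_deriv_eq_sub] at h
  linarith

/-- The composition of a map that is continuous on `univ ×ˢ D` with a continuous first argument and
a measurable `D`-valued second argument is measurable. -/
theorem measurable_comp_of_continuousOn_univ_prod {n m : ℕ} {D : Set (Eu m)}
    {F : Eu n → Eu m → Eu n}
    (hF : ContinuousOn (fun p : Eu n × Eu m => F p.1 p.2) (univ ×ˢ D))
    {φ : ℝ → Eu n} (hφ : Continuous φ) {d : ℝ → Eu m} (hd : Measurable d)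
    (hdD : ∀ t, d t ∈ D) : Measurable fun t => F (φ t) (d t) := by
  have h := (continuousOn_iff_continuous_domRestrict.mp hF).measurable
  have hpair : Measurable fun t =>
      (⟨(φ t, d t), mem_univ _, hdD t⟩ : (univ ×ˢ D : Set (Eu n × Eu m))) :=
    (hφ.measurable.prodMk hd).subtype_mk
  exact h.comp hpair

/-- The primitive of a bounded measurable function is Lipschitz. -/
theorem lipschitzWith_add_intervalIntegral {n : ℕ} {v : ℝ → Eu n} (x₀ : Eu n) {C : ℝ≥0}
    (hv : ∀ a b, IntervalIntegrable v volume a b) (hC : ∀ t, ‖v t‖ ≤ C) :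
    LipschitzWith C fun t => x₀ + ∫ s in (0:ℝ)..t, v s := by
  refine LipschitzWith.of_dist_le_mul fun a b => ?_
  rw [dist_add_left, dist_eq_norm, intervalIntegral.integral_interval_sub_left (hv _ _) (hv _ _),
    Real.dist_eq]
  exact intervalIntegral.norm_integral_le_of_norm_le_const fun t _ => hC t

/-- Gronwall-type consequence of the differential inequality
−∇u·F − δ g (1 − u) ≥ 0 along a trajectory. -/
theorem statement_16
    {n m : ℕ} (D : Set (Eu m)) (hD : IsCompact D)
    (F : Eu n → Eu m → Eu n)
    (hF : ContinuousOn (fun p : Eu n × Eu m => F p.1 p.2) (univ ×ˢ D))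
    (g : Eu n → ℝ) (hg : Continuous g)
    (u : Eu n → ℝ) (hu : ContDiff ℝ 1 u)
    (δ : ℝ) (hδ : 0 < δ) (τ : ℝ) (hτ : 0 < τ)
    (d : ℝ → Eu m) (hd : Measurable d) (hdD : ∀ t : ℝ, d t ∈ D)
    (ψ : ℝ → Eu n) (hψ : IsTrajOn F (ψ 0) d (Icc 0 τ) ψ)
    (S : Set (Eu n)) (hψS : ∀ t ∈ Icc (0:ℝ) τ, ψ t ∈ S)
    (hineq : ∀ x ∈ S, ∀ d' ∈ D,
      0 ≤ -(fderiv ℝ u x (F x d')) - δ * g x * (1 - u x)) :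
    Real.exp (-(δ * (∫ t in (0:ℝ)..τ, g (ψ t)))) * (u (ψ τ) - 1) ≤ u (ψ 0) - 1 := by
  obtain ⟨hcont, hψint⟩ := hψ
  set ψ' : ℝ → Eu n := IccExtend hτ.le ((Icc 0 τ).domRestrict ψ) with hψ'
  have hψ'c : Continuous ψ' := (continuousOn_iff_continuous_domRestrict.mp hcont).Icc_extend'
  have hψ'eq : ∀ t ∈ Icc (0:ℝ) τ, ψ' t = ψ t := fun t ht => by
    rw [hψ', IccExtend_of_mem _ _ ht, domRestrict_apply]
  have hψ'mem : ∀ t, ψ' t ∈ ψ '' Icc 0 τ := fun t =>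
    ⟨projIcc 0 τ hτ.le t, (projIcc 0 τ hτ.le t).2, rfl⟩
  set v : ℝ → Eu n := fun t => F (ψ' t) (d t) with hv
  have hvm : Measurable v := measurable_comp_of_continuousOn_univ_prod hF hψ'c hd hdD
  obtain ⟨C₀, hC₀⟩ :=
    ((isCompact_Icc.image_of_continuousOn hcont).prod hD).exists_bound_of_continuousOn
      (hF.mono (prod_mono (subset_univ _) Subset.rfl))
  have hC : ∀ t, ‖v t‖ ≤ C₀.toNNReal := fun t =>
    (hC₀ (ψ' t, d t) ⟨hψ'mem t, hdD t⟩).trans (Real.le_coe_toNNReal _)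
  have hvi : ∀ a b, IntervalIntegrable v volume a b := fun a b =>
    (intervalIntegrable_const (c := (C₀.toNNReal : ℝ))).mono_fun hvm.aestronglyMeasurable
      (Eventually.of_forall fun t => (hC t).trans (Real.le_norm_self _))
  set φ : ℝ → Eu n := fun t => ψ 0 + ∫ s in (0:ℝ)..t, v s with hφ
  have hφψ : ∀ t ∈ Icc (0:ℝ) τ, φ t = ψ t := fun t ht => by
    rw [hφ, hψint t ht]
    refine congrArg _ (intervalIntegral.integral_congr fun s hs => ?_)
    rw [uIcc_of_le ht.1] at hs
    simp only [hv, hψ'eq s ⟨hs.1, hs.2.trans ht.2⟩]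
  have hφL : LipschitzWith C₀.toNNReal φ := lipschitzWith_add_intervalIntegral _ hvi hC
  have huφ : AbsolutelyContinuousOnInterval (fun t => u (φ t) - 1) 0 τ := by
    obtain ⟨K, hK⟩ := ((hu.sub contDiff_const).locallyLipschitz
      (f := fun x => u x - 1)).locallyLipschitzOn.exists_lipschitzOnWith_of_compact
        ((isCompact_uIcc (a := (0:ℝ)) (b := τ)).image hφL.continuous)
    exact (hK.comp hφL.lipschitzOnWith (mapsTo_image _ _)).absolutelyContinuousOnInterval
  have hgc : Continuous fun t => g (ψ' t) := hg.comp hψ'c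
  set E : ℝ → ℝ := fun t => Real.exp (-(δ * ∫ s in (0:ℝ)..t, g (ψ' s))) with hE
  have hE' : ∀ t, HasDerivAt E (E t * -(δ * g (ψ' t))) t := fun t =>
    ((hgc.integral_hasStrictDerivAt 0 t).hasDerivAt.const_mul δ).neg.exp
  have hEac : AbsolutelyContinuousOnInterval E 0 τ := by
    refine (contDiff_one_iff_deriv.mpr ⟨fun t => (hE' t).differentiableAt, ?_⟩
      ).contDiffOn.absolutelyContinuousOnInterval
    have hEc : Continuous E := continuous_iff_continuousAt.mpr fun t => (hE' t).continuousAt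
    rw [funext fun t => (hE' t).deriv]
    fun_prop
  have hderiv : ∀ᵐ t, t ∈ Icc 0 τ → deriv (fun t => E t * (u (φ t) - 1)) t ≤ 0 := by
    filter_upwards [(hvi 0 τ).ae_hasDerivAt_integral] with t ht hmem
    have hφ' : HasDerivAt φ (v t) t :=
      (ht (uIcc_of_le hτ.le ▸ hmem) 0 left_mem_uIcc).const_add _
    have hu' : HasDerivAt (fun t => u (φ t)) (fderiv ℝ u (φ t) (v t)) t :=
      ((hu.differentiable one_ne_zero).differentiableAt.hasFDerivAt).comp_hasDerivAt t hφ'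
    have hle := hineq (ψ t) (hψS t hmem) (d t) (hdD t)
    rw [((hE' t).fun_mul (hu'.sub_const 1)).deriv, hφψ t hmem]
    simp only [hv, hψ'eq t hmem]
    have hEpos : 0 < E t := Real.exp_pos _
    nlinarith [mul_nonneg hEpos.le hle]
  have key := AbsolutelyContinuousOnInterval.le_of_ae_deriv_nonpos hτ.le (hEac.mul huφ) hderiv
  have hG : ∫ s in (0:ℝ)..τ, g (ψ' s) = ∫ s in (0:ℝ)..τ, g (ψ s) :=
    intervalIntegral.integral_congr fun s hs => by
      rw [uIcc_of_le hτ.le] at hs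
      simp only [hψ'eq s hs]
  simpa [hE, hG, hφψ τ ⟨hτ.le, le_rfl⟩, hφψ 0 ⟨le_rfl, hτ.le⟩] using key
end
end

section
/- Let δ be a positive odd integer and let u : ℝ^n → ℝ be continuously differentiable and satisfy: (i) −∇u(x)·f(x,d) − δ·q(x)·(1 − u(x)) ≥ 0 for all x ∈ B̄ ∖ X∞ and all d ∈ D; (ii) u(x) + (1 − h_j(x))^δ − 1 ≥ 0 for all j = 1,…,n_X and all x ∈ closure(X) ∖ X∞; (iii) u(x) − 1 ≥ 0 for all x ∈ B̄ ∖ X. Set Ω := {x ∈ B̄ : u(x) < 1}. Then every trajectory starting in Ω never leaves X: for every x₀ ∈ Ω, every admissible input d, every T > 0, and every trajectory ψ of f from x₀ under d on [0,T], one has ψ(t) ∈ X for all t ∈ [0,T]. -/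
open MeasureTheory Metric Set Filter Topology

open scoped ENNReal NNReal

attribute [local instance] Classical.propDecidable

noncomputable section

theorem contDiff_mvPolynomial_eval {E σ : Type*} [NormedAddCommGroup E] [NormedSpace ℝ E]
    {k : WithTop ℕ∞} (p : MvPolynomial σ ℝ) {g : E → σ → ℝ}
    (hg : ∀ i, ContDiff ℝ k fun x => g x i) :
    ContDiff ℝ k fun x => MvPolynomial.eval (g x) p := by
  induction p using MvPolynomial.induction_on with
  | C a => simpa using contDiff_const
  | add p q hp hq => simpa using hp.add hq
  | mul_X p i hp => simpa using hp.mul (hg i)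

theorem IsPolyMap.contDiff_s17 {n m : ℕ} {f : Eu n → Eu m → Eu n} (hf : IsPolyMap f)
    {k : WithTop ℕ∞} : ContDiff ℝ k fun z : Eu n × Eu m => f z.1 z.2 := by
  obtain ⟨p, hp⟩ := hf
  rw [contDiff_euclidean]
  intro i
  simp only [hp]
  refine contDiff_mvPolynomial_eval (p i) ?_
  rintro (j | j)
  · simp only [Sum.elim_inl]; fun_prop
  · simp only [Sum.elim_inr]; fun_prop

theorem IsPolyMap.continuous {n m : ℕ} {f : Eu n → Eu m → Eu n} (hf : IsPolyMap f) :
    Continuous fun z : Eu n × Eu m => f z.1 z.2 :=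
  (hf.contDiff_s17 (k := 0)).continuous

section Trajectories

variable {n m : ℕ} {f : Eu n → Eu m → Eu n} {D : Set (Eu m)} {d : ℝ → Eu m}
  {x₀ : Eu n} {ψ : ℝ → Eu n} {T : ℝ}

theorem IsAdmissible.comp_add_left (hd : IsAdmissible D d) (t₀ : ℝ) :
    IsAdmissible D fun t => d (t₀ + t) :=
  ⟨hd.1.comp (measurable_const_add t₀), fun _ => hd.2 _⟩

theorem IsAdmissible.intervalIntegrable (hf : IsPolyMap f) (hD : IsCompact D)
    (hd : IsAdmissible D d) {a b : ℝ} (hψ : ContinuousOn ψ (uIcc a b)) :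
    IntervalIntegrable (fun s => f (ψ s) (d s)) volume a b := by
  obtain ⟨M, hM⟩ := ((isCompact_uIcc.image_of_continuousOn hψ).prod hD).exists_bound_of_continuousOn
    hf.continuous.continuousOn
  rw [intervalIntegrable_iff']
  have hmeas : AEStronglyMeasurable (fun s => f (ψ s) (d s)) (volume.restrict (uIcc a b)) :=
    hf.continuous.comp_aestronglyMeasurable
      ((hψ.aestronglyMeasurable measurableSet_uIcc).prodMk hd.1.aestronglyMeasurable)
  refine IntegrableOn.of_bound isCompact_uIcc.measure_lt_top hmeas M ?_
  filter_upwards [ae_restrict_mem measurableSet_uIcc] with s hs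
  exact hM (ψ s, d s) ⟨mem_image_of_mem ψ hs, hd.2 s⟩

theorem IsTrajOn.apply_zero (hψ : IsTrajOn f x₀ d (Icc 0 T) ψ) (hT : 0 ≤ T) : ψ 0 = x₀ := by
  simpa using hψ.2 0 ⟨le_rfl, hT⟩

theorem IsTrajOn.sub_eq_integral_s17 (hf : IsPolyMap f) (hD : IsCompact D) (hd : IsAdmissible D d)
    (hψ : IsTrajOn f x₀ d (Icc 0 T) ψ) {a b : ℝ} (ha : a ∈ Icc 0 T) (hb : b ∈ Icc 0 T) :
    ψ b - ψ a = ∫ s in a..b, f (ψ s) (d s) := by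
  have hT : (0 : ℝ) ∈ Icc 0 T := ⟨le_rfl, ha.1.trans ha.2⟩
  have hfint : ∀ c ∈ Icc 0 T, IntervalIntegrable (fun s => f (ψ s) (d s)) volume 0 c :=
    fun c hc => hd.intervalIntegrable hf hD (hψ.1.mono (uIcc_subset_Icc hT hc))
  rw [hψ.2 b hb, hψ.2 a ha, add_sub_add_left_eq_sub,
    intervalIntegral.integral_interval_sub_left (hfint b hb) (hfint a ha)]

theorem IsTrajOn.comp_add_left (hf : IsPolyMap f) (hD : IsCompact D) (hd : IsAdmissible D d)
    (hψ : IsTrajOn f x₀ d (Icc 0 T) ψ) {t₀ : ℝ} (ht₀ : t₀ ∈ Icc 0 T) :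
    IsTrajOn f (ψ t₀) (fun t => d (t₀ + t)) (Icc 0 (T - t₀)) fun t => ψ (t₀ + t) := by
  have hmem : ∀ t ∈ Icc 0 (T - t₀), t₀ + t ∈ Icc 0 T := fun t ht =>
    ⟨add_nonneg ht₀.1 ht.1, by linarith [ht.2]⟩
  refine ⟨hψ.1.comp (continuous_const.add continuous_id).continuousOn hmem, fun t ht => ?_⟩
  rw [intervalIntegral.integral_comp_add_left (fun s => f (ψ s) (d s)), add_zero,
    ← hψ.sub_eq_integral_s17 hf hD hd ht₀ (hmem t ht), add_sub_cancel]

theorem eq_zero_of_le_const_mul_integral {g : ℝ → ℝ} {K : ℝ}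
    (hg : ContinuousOn g (Icc 0 T)) (hg0 : ∀ t ∈ Icc 0 T, 0 ≤ g t)
    (hle : ∀ t ∈ Icc 0 T, g t ≤ K * ∫ s in (0 : ℝ)..t, g s) {t : ℝ} (ht : t ∈ Icc 0 T) :
    g t = 0 := by
  have hT : 0 ≤ T := ht.1.trans ht.2
  set φ : ℝ → ℝ := Set.IccExtend hT ((Icc 0 T).domRestrict g)
  have hφc : Continuous φ := hg.domRestrict.Icc_extend'
  have hφ : ∀ s ∈ Icc 0 T, φ s = g s := fun s hs => IccExtend_of_mem hT _ hs
  have hG : ∀ s ∈ Icc 0 T, ∫ r in (0 : ℝ)..s, g r = ∫ r in (0 : ℝ)..s, φ r := fun s hs =>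
    intervalIntegral.integral_congr fun r hr =>
      (hφ r (uIcc_subset_Icc ⟨le_rfl, hT⟩ hs hr)).symm
  have hnonneg : ∀ s ∈ Icc 0 T, 0 ≤ ∫ r in (0 : ℝ)..s, φ r := fun s hs => by
    rw [← hG s hs]
    exact intervalIntegral.integral_nonneg hs.1 fun r hr => hg0 r ⟨hr.1, hr.2.trans hs.2⟩
  have hderiv : ∀ s, HasDerivAt (fun t => ∫ r in (0 : ℝ)..t, φ r) (φ s) s := fun s =>
    (hφc.integral_hasStrictDerivAt 0 s).hasDerivAt
  have key := norm_le_gronwallBound_of_norm_deriv_right_le (δ := 0) (K := K) (ε := 0)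
    (f := fun t => ∫ r in (0 : ℝ)..t, φ r) (f' := φ) (a := 0) (b := T)
    (fun s _ => (hderiv s).continuousAt.continuousWithinAt)
    (fun s _ => (hderiv s).hasDerivWithinAt) (by simp)
    (fun s hs => by
      have hs' := Ico_subset_Icc_self hs
      rw [hφ s hs', add_zero, Real.norm_of_nonneg (hg0 s hs'),
        Real.norm_of_nonneg (hnonneg s hs'), ← hG s hs']
      exact hle s hs') t ht
  have h0 : ∫ r in (0 : ℝ)..t, φ r = 0 := by
    simpa [gronwallBound_ε0] using key
  refine le_antisymm ?_ (hg0 t ht)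
  simpa [hG t ht, h0] using hle t ht

theorem IsTrajOn.eqOn (hf : IsPolyMap f) (hD : IsCompact D) (hd : IsAdmissible D d)
    {ψ₁ ψ₂ : ℝ → Eu n} (h₁ : IsTrajOn f x₀ d (Icc 0 T) ψ₁) (h₂ : IsTrajOn f x₀ d (Icc 0 T) ψ₂) :
    EqOn ψ₁ ψ₂ (Icc 0 T) := by
  obtain ⟨R, hR⟩ := ((isCompact_Icc.image_of_continuousOn h₁.1).union
    (isCompact_Icc.image_of_continuousOn h₂.1)).isBounded.subset_closedBall 0
  obtain ⟨R', hR'⟩ := hD.isBounded.subset_closedBall 0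
  obtain ⟨K, hK⟩ := (hf.contDiff_s17 (k := 1)).contDiffOn.exists_lipschitzOnWith one_ne_zero
    ((convex_closedBall (0 : Eu n) R).prod (convex_closedBall (0 : Eu m) R'))
    ((isCompact_closedBall _ _).prod (isCompact_closedBall _ _))
  have hLip : ∀ s ∈ Icc 0 T, ‖f (ψ₁ s) (d s) - f (ψ₂ s) (d s)‖ ≤ K * ‖ψ₁ s - ψ₂ s‖ := by
    intro s hs
    have := hK.norm_sub_le (x := (ψ₁ s, d s)) (y := (ψ₂ s, d s))
      ⟨hR (.inl (mem_image_of_mem _ hs)), hR' (hd.2 s)⟩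
      ⟨hR (.inr (mem_image_of_mem _ hs)), hR' (hd.2 s)⟩
    simpa [Prod.norm_def] using this
  intro t ht
  have h0 : ∀ s ∈ Icc 0 T, uIcc 0 s ⊆ Icc 0 T := fun s hs =>
    uIcc_subset_Icc ⟨le_rfl, hs.1.trans hs.2⟩ hs
  have hcont : ContinuousOn (fun s => ‖ψ₁ s - ψ₂ s‖) (Icc 0 T) := (h₁.1.sub h₂.1).norm
  have hz := eq_zero_of_le_const_mul_integral (K := K) hcont (fun _ _ => norm_nonneg _) ?_ ht
  · exact sub_eq_zero.1 (norm_eq_zero.1 hz)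
  intro s hs
  have i₁ := hd.intervalIntegrable hf hD (h₁.1.mono (h0 s hs))
  have i₂ := hd.intervalIntegrable hf hD (h₂.1.mono (h0 s hs))
  rw [h₁.2 s hs, h₂.2 s hs, add_sub_add_left_eq_sub, ← intervalIntegral.integral_sub i₁ i₂,
    ← intervalIntegral.integral_const_mul]
  refine (intervalIntegral.norm_integral_le_integral_norm hs.1).trans
    (intervalIntegral.integral_mono_on hs.1 (i₁.sub i₂).norm
      ((hcont.mono (h0 s hs)).intervalIntegrable.const_mul _) fun r hr => ?_)
  exact hLip r ⟨hr.1, hr.2.trans hs.2⟩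

theorem IsTrajOn.eventually_slope_comp_lt (hf : IsPolyMap f) (hD : IsCompact D)
    (hd : IsAdmissible D d) (hψ : IsTrajOn f x₀ d (Icc 0 T) ψ) {t : ℝ} (ht : t ∈ Ico 0 T)
    {u : Eu n → ℝ} (hu : DifferentiableAt ℝ u (ψ t)) {c r : ℝ}
    (hc : ∀ e ∈ D, fderiv ℝ u (ψ t) (f (ψ t) e) ≤ c) (hr : c < r) :
    ∀ᶠ z in 𝓝[>] t, slope (fun s => u (ψ s)) t z < r := by
  set L := fderiv ℝ u (ψ t)
  obtain ⟨M, hM⟩ := hD.exists_bound_of_continuousOn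
    (f := fun e => f (ψ t) e)
    (hf.continuous.comp (by fun_prop : Continuous fun e => (ψ t, e))).continuousOn
  have hMpos : 0 < max M 0 + 1 := by positivity
  set ε := (r - c) / 4 with hε
  have hεpos : 0 < ε := by rw [hε]; linarith
  have hLc : Continuous fun z : Eu n × Eu m => L (f z.1 z.2) := L.continuous.comp hf.continuous
  have e₁ : ∀ᶠ y in 𝓝 (ψ t), ∀ e ∈ D, L (f y e) < c + ε :=
    hD.eventually_forall_of_forall_eventually fun e he =>
      hLc.continuousAt.eventually_lt continuousAt_const (by linarith [hc e he])
  have e₂ : ∀ᶠ y in 𝓝 (ψ t), ∀ e ∈ D, ‖f y e‖ < max M 0 + 1 :=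
    hD.eventually_forall_of_forall_eventually fun e he =>
      hf.continuous.norm.continuousAt.eventually_lt continuousAt_const
        (by linarith [hM e he, le_max_left M 0])
  have e₃ : ∀ᶠ y in 𝓝 (ψ t),
      ‖u y - u (ψ t) - L (y - ψ t)‖ ≤ ε / (max M 0 + 1) * ‖y - ψ t‖ :=
    hu.hasFDerivAt.isLittleO.def (div_pos hεpos hMpos)
  have htend : Tendsto ψ (𝓝[≥] t) (𝓝 (ψ t)) :=
    (hψ.1 t (Ico_subset_Icc_self ht)).mono_of_mem_nhdsWithin
      (mem_of_superset (Icc_mem_nhdsGE ht.2) (Icc_subset_Icc_left ht.1))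
  obtain ⟨b, hb, hball⟩ := (mem_nhdsGE_iff_exists_Ico_subset' ht.2).1
    (htend.eventually (e₁.and (e₂.and e₃)))
  filter_upwards [Ioo_mem_nhdsGT (lt_min hb ht.2)] with z hz
  have hzb : z < b := hz.2.trans_le (min_le_left _ _)
  have hzT : z < T := hz.2.trans_le (min_le_right _ _)
  have hsub : Icc t z ⊆ Icc 0 T := Icc_subset_Icc ht.1 hzT.le
  have hH : ∀ s ∈ Icc t z, _ := fun s hs => hball ⟨hs.1, hs.2.trans_lt hzb⟩
  have hfint : IntervalIntegrable (fun s => f (ψ s) (d s)) volume t z :=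
    hd.intervalIntegrable hf hD (hψ.1.mono (by rwa [uIcc_of_le hz.1.le]))
  have hsubint := hψ.sub_eq_integral_s17 hf hD hd (Ico_subset_Icc_self ht)
    (hsub ⟨hz.1.le, le_rfl⟩)
  have hzt : 0 < z - t := sub_pos.2 hz.1
  have b₁ : L (ψ z - ψ t) ≤ (c + ε) * (z - t) := by
    rw [hsubint, ← L.intervalIntegral_comp_comm hfint]
    refine (intervalIntegral.integral_mono_on hz.1.le ⟨L.integrable_comp hfint.1,
      L.integrable_comp hfint.2⟩ intervalIntegrable_const
      fun s hs => ((hH s hs).1 _ (hd.2 s)).le).trans_eq ?_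
    simp only [intervalIntegral.integral_const, smul_eq_mul, mul_comm]
  have b₂ : ‖ψ z - ψ t‖ ≤ (max M 0 + 1) * (z - t) := by
    rw [hsubint, ← abs_of_pos hzt]
    refine intervalIntegral.norm_integral_le_of_norm_le_const fun s hs => ?_
    rw [uIoc_of_le hz.1.le] at hs
    exact ((hH s (Ioc_subset_Icc_self hs)).2.1 _ (hd.2 s)).le
  have b₃ : u (ψ z) - u (ψ t) - L (ψ z - ψ t) ≤ ε * (z - t) := by
    refine ((le_abs_self _).trans (hH z ⟨hz.1.le, le_rfl⟩).2.2).trans ?_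
    refine (mul_le_mul_of_nonneg_left b₂ (div_pos hεpos hMpos).le).trans_eq ?_
    field_simp
  rw [slope_def_field, div_lt_iff₀ hzt]
  have : (c + 2 * ε) * (z - t) < r * (z - t) :=
    mul_lt_mul_of_pos_right (by rw [hε]; linarith) hzt
  linarith

end Trajectories

theorem lt_of_forall_frequently_slope_lt {v k : ℝ → ℝ} {a b c : ℝ} (hab : a ≤ b)
    (hv : ContinuousOn v (Icc a b)) (hk : ∀ t ∈ Ico a b, 0 ≤ k t)
    (hslope : ∀ t ∈ Ico a b, ∀ r, -(k t * (c - v t)) < r → ∃ᶠ z in 𝓝[>] t, slope v t z < r)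
    (ha : v a < c) : v b < c := by
  set ε := (c - v a) / (2 * (b - a + 1)) with hε
  have hden : 0 < 2 * (b - a + 1) := by linarith
  have hεpos : 0 < ε := div_pos (by linarith) hden
  have hB : ∀ t ∈ Icc a b, v a + ε * (t - a) < c := by
    intro t ht
    have h1 : ε * (t - a) ≤ ε * (b - a + 1) :=
      mul_le_mul_of_nonneg_left (by linarith [ht.2]) hεpos.le
    have h2 : ε * (2 * (b - a + 1)) = c - v a := div_mul_cancel₀ _ hden.ne'
    linarith
  have := image_le_of_liminf_slope_right_lt_deriv_boundary' hv hslope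
    (B := fun t => v a + ε * (t - a)) (B' := fun _ => ε) (by simp) (by fun_prop)
    (fun t _ => by
      simpa using ((((hasDerivAt_id t).sub_const a).const_mul ε).const_add (v a)).hasDerivWithinAt)
    (fun t ht heq => by
      have := mul_nonneg (hk t ht) (by linarith [hB t (Ico_subset_Icc_self ht)] : 0 ≤ c - v t)
      linarith) ⟨hab, le_rfl⟩
  exact this.trans_lt (hB b ⟨hab, le_rfl⟩)

/-- Every trajectory starting in Ω = {x ∈ B̄ : u(x) < 1} never leaves X. -/
theorem statement_17
    {n m nX : ℕ} (hnX : 0 < nX)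
    (f : Eu n → Eu m → Eu n) (hfpoly : IsPolyMap f)
    (D : Set (Eu m)) (hD : IsCompact D)
    (h : Fin nX → Eu n → ℝ) (hhpoly : ∀ j, IsPolyFun (h j))
    (hhnn : ∀ j x, 0 ≤ h j x) (hh0 : ∀ j, h j (0 : Eu n) = 0)
    (X : Set (Eu n)) (hXdef : X = {x | ∀ j, h j x < 1})
    (hXbdd : Bornology.IsBounded X)
    (α : ℝ) (hα : 0 < α) (s : ℕ) (hs : 2 ≤ s)
    (q : Eu n → ℝ) (hqpoly : IsPolyFun q) (hqnn : ∀ x, 0 ≤ q x)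
    (hq0 : q (0 : Eu n) = 0) (hqpos : ∀ x : Eu n, x ≠ 0 → 0 < q x)
    (Xinf : Set (Eu n)) (hXinfdef : Xinf = {x | q x < α})
    (hXinfbdd : Bornology.IsBounded Xinf)
    (Rad : ℝ) (hRad : 0 < Rad) (Bbar : Set (Eu n))
    (hBbar : Bbar = Metric.closedBall (0 : Eu n) Rad)
    (hXB : closure X ⊆ Metric.ball (0 : Eu n) Rad)
    (h0Xinf : (0 : Eu n) ∈ Xinf) (hXinfX : closure Xinf ⊆ X)
    (hattr : ∀ x₀ ∈ Xinf, ∀ d, IsAdmissible D d →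
      (∃ ψ', IsTrajOn f x₀ d (Ici 0) ψ') ∧
      ∀ ψ', IsTrajOn f x₀ d (Ici 0) ψ' →
        (∀ t : ℝ, 0 ≤ t → ψ' t ∈ X) ∧ Tendsto ψ' atTop (nhds (0 : Eu n)))
    (δ : ℕ) (hδodd : Odd δ) (hδpos : 0 < δ)
    (u : Eu n → ℝ) (hu : ContDiff ℝ 1 u)
    (hc1 : ∀ x ∈ Bbar \ Xinf, ∀ d ∈ D,
      0 ≤ -(fderiv ℝ u x (f x d)) - (δ : ℝ) * q x * (1 - u x))
    (hc2 : ∀ j : Fin nX, ∀ x ∈ closure X \ Xinf, 0 ≤ u x + (1 - h j x) ^ δ - 1)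
    (hc3 : ∀ x ∈ Bbar \ X, 0 ≤ u x - 1)
 :
    ∀ x₀ ∈ {x ∈ Bbar | u x < 1}, ∀ d, IsAdmissible D d → ∀ T : ℝ, 0 < T →
      ∀ ψ', IsTrajOn f x₀ d (Icc 0 T) ψ' → ∀ t ∈ Icc (0:ℝ) T, ψ' t ∈ X := by
  rintro x₀ ⟨hx₀B, hx₀u⟩ d hd T hT ψ hψ t ht
  by_contra htX
  have hXopen : IsOpen X := by
    rw [hXdef, Set.ofPred_forall]
    exact isOpen_iInter_of_finite fun j => isOpen_lt (hhpoly j).continuous continuous_const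
  have hXball : closure X ⊆ Bbar := hBbar ▸ hXB.trans ball_subset_closedBall
  obtain ⟨τ, ⟨hτ, hτX⟩, hleast⟩ :=
    (isCompact_Icc.of_isClosed_subset (hψ.1.preimage_isClosed_of_isClosed isClosed_Icc
      hXopen.isClosed_compl) inter_subset_left).exists_isLeast ⟨t, ht, htX⟩
  have hbefore : ∀ s ∈ Ico 0 τ, ψ s ∈ X := fun s hs => by
    by_contra hsX
    exact hs.2.not_ge (hleast ⟨⟨hs.1, hs.2.le.trans hτ.2⟩, hsX⟩)
  have hψ0 : ψ 0 = x₀ := hψ.apply_zero hT.le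
  have hτpos : 0 < τ := by
    refine hτ.1.lt_of_ne fun h0 => ?_
    rw [← h0, mem_preimage, hψ0] at hτX
    linarith [hc3 x₀ ⟨hx₀B, hτX⟩]
  have hτB : ψ τ ∈ Bbar := hXball <| ContinuousWithinAt.mem_closure (s := Ico 0 τ)
    ((hψ.1 τ hτ).mono ((Icc_subset_Icc_right hτ.2).trans' Ico_subset_Icc_self))
    (by rw [closure_Ico hτpos.ne]; exact ⟨hτ.1, le_rfl⟩) hbefore
  have havoid : ∀ s ∈ Icc 0 τ, ψ s ∉ Xinf := fun s hs hsinf => by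
    have hs' : s ∈ Icc 0 T := ⟨hs.1, hs.2.trans hτ.2⟩
    obtain ⟨⟨φ, hφ⟩, hall⟩ := hattr (ψ s) hsinf _ (hd.comp_add_left s)
    have hφT : IsTrajOn f (ψ s) (fun t => d (s + t)) (Icc 0 (T - s)) φ :=
      ⟨hφ.1.mono Icc_subset_Ici_self, fun t ht => hφ.2 t ht.1⟩
    have heq := (hψ.comp_add_left hfpoly hD hd hs').eqOn hfpoly hD (hd.comp_add_left s) hφT
      (x := τ - s) ⟨sub_nonneg.2 hs.2, sub_le_sub_right hτ.2 s⟩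
    simp only [add_sub_cancel] at heq
    exact hτX (heq ▸ (hall φ hφ).1 _ (sub_nonneg.2 hs.2))
  have hlt : u (ψ τ) < 1 := by
    refine lt_of_forall_frequently_slope_lt (v := fun s => u (ψ s))
      (k := fun s => δ * q (ψ s)) hτ.1
      (hu.continuous.comp_continuousOn (hψ.1.mono (Icc_subset_Icc_right hτ.2)))
      (fun s _ => mul_nonneg δ.cast_nonneg (hqnn _)) (fun s hs r hr => ?_) (by rwa [hψ0])
    refine (hψ.eventually_slope_comp_lt hfpoly hD hd ⟨hs.1, hs.2.trans_le hτ.2⟩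
      (hu.differentiable one_ne_zero _) (fun e he => ?_) hr).frequently
    linarith [hc1 (ψ s) ⟨hXball (subset_closure (hbefore s hs)),
      havoid s (Ico_subset_Icc_self hs)⟩ e he]
  linarith [hc3 (ψ τ) ⟨hτB, hτX⟩]
end
end
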